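/- arXiv:math/0203218 — 2 statements merged into one kernel-verified Lean document; each statement's English description precedes it below -/
import Mathlib

section
/- L³ space-time estimate in ℝ^{3+1}. Let ε > 0 be sufficiently small. There is a constant C such that for every Schwartz function ψ on ℝ³ × ℝ, ‖ψ‖_{L³_{t,x}(ℝ × ℝ³)} ≤ C ‖ψ‖_{X_{0, 1/2−2ε}}. -/
open MeasureTheory Complex Set
open scoped FourierTransform BigOperators RealInnerProductSpace

noncomputable section

abbrev Rn (n : ℕ) := EuclideanSpace ℝ (Fin n)

/-- Japanese bracket of a vector. -/
def jap {n : ℕ} (ξ : Rn n) : ℝ := Real.sqrt (1 + ‖ξ‖ ^ 2)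

/-- Japanese bracket of a real number. -/
def japR (x : ℝ) : ℝ := Real.sqrt (1 + x ^ 2)

/-- Inhomogeneous Sobolev norm ‖⟨ξ⟩^s f̂‖_{L²}. -/
def sobNorm (n : ℕ) (s : ℝ) (f : Rn n → ℂ) : ℝ :=
  (∫ ξ : Rn n, jap ξ ^ (2 * s) * ‖𝓕 f ξ‖ ^ 2) ^ (1/2 : ℝ)

/-- Homogeneous Sobolev norm ‖|ξ|^s f̂‖_{L²}. -/
def sobNormHom (n : ℕ) (s : ℝ) (f : Rn n → ℂ) : ℝ :=
  (∫ ξ : Rn n, ‖ξ‖ ^ (2 * s) * ‖𝓕 f ξ‖ ^ 2) ^ (1/2 : ℝ)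

/-- L^p norm on ℝⁿ. -/
def lpNorm (n : ℕ) (p : ℝ) (f : Rn n → ℂ) : ℝ :=
  (∫ x : Rn n, ‖f x‖ ^ p) ^ (1/p)

/-- Laplacian: sum of second partial derivatives. -/
def laplacian {n : ℕ} (f : Rn n → ℂ) (x : Rn n) : ℂ :=
  ∑ i : Fin n, fderiv ℝ (fun y => fderiv ℝ f y (EuclideanSpace.single i 1)) x
    (EuclideanSpace.single i 1)

/-- Complex gradient as a vector in Euclidean space. -/
def gradC {n : ℕ} (f : Rn n → ℂ) (x : Rn n) : EuclideanSpace ℂ (Fin n) :=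
  (WithLp.equiv 2 (Fin n → ℂ)).symm fun i => fderiv ℝ f x (EuclideanSpace.single i 1)

/-- φ is a solution of the cubic defocussing NLS on ℝⁿ × [0,T] with data φ₀:
smooth, Schwartz in x uniformly for t ∈ [0,T] (with all derivatives),
satisfying i∂ₜφ + Δφ = |φ|²φ and φ(·,0) = φ₀. -/
def IsNLSSolution (n : ℕ) (T : ℝ) (φ : Rn n → ℝ → ℂ) (φ₀ : Rn n → ℂ) : Prop :=
  ContDiff ℝ (⊤ : ℕ∞) (fun p : Rn n × ℝ => φ p.1 p.2) ∧
  (∀ k l : ℕ, ∃ C : ℝ, ∀ t ∈ Icc (0:ℝ) T, ∀ x : Rn n,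
      ‖x‖ ^ k * ‖iteratedFDeriv ℝ l (fun y => φ y t) x‖ ≤ C) ∧
  (∀ x : Rn n, ∀ t ∈ Icc (0:ℝ) T,
      Complex.I * deriv (fun t' => φ x t') t + laplacian (fun y => φ y t) x
        = (‖φ x t‖ : ℂ) ^ 2 * φ x t) ∧
  (∀ x : Rn n, φ x 0 = φ₀ x)

/-- The energy E(f) = ∫ (1/2)|∇f|² + (1/4)|f|⁴. -/
def energy {n : ℕ} (f : Rn n → ℂ) : ℝ :=
  ∫ x : Rn n, ((1/2 : ℝ) * ∑ i : Fin n, ‖fderiv ℝ f x (EuclideanSpace.single i 1)‖ ^ 2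
    + (1/4 : ℝ) * ‖f x‖ ^ 4)

/-- m₁ is a smooth, radially symmetric, nonincreasing multiplier with
m₁ = 1 on the unit ball, m₁(ξ) = |ξ|^{-(1-s)} for |ξ| ≥ 2, 0 < m₁ ≤ 1. -/
def IsAdmissibleMultiplier (n : ℕ) (s : ℝ) (m₁ : Rn n → ℝ) : Prop :=
  ContDiff ℝ (⊤ : ℕ∞) m₁ ∧
  (∀ ξ : Rn n, 0 < m₁ ξ ∧ m₁ ξ ≤ 1) ∧
  (∀ ξ η : Rn n, ‖ξ‖ = ‖η‖ → m₁ ξ = m₁ η) ∧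
  (∀ ξ η : Rn n, ‖ξ‖ ≤ ‖η‖ → m₁ η ≤ m₁ ξ) ∧
  (∀ ξ : Rn n, ‖ξ‖ ≤ 1 → m₁ ξ = 1) ∧
  (∀ ξ : Rn n, 2 ≤ ‖ξ‖ → m₁ ξ = ‖ξ‖ ^ (-(1 - s)))

/-- The rescaled multiplier m_N(ξ) = m₁(ξ/N). -/
def mN {n : ℕ} (m₁ : Rn n → ℝ) (N : ℝ) (ξ : Rn n) : ℝ := m₁ (N⁻¹ • ξ)

/-- The smoothing operator I_N with Fourier multiplier m_N. -/
def Iop {n : ℕ} (m₁ : Rn n → ℝ) (N : ℝ) (f : Rn n → ℂ) : Rn n → ℂ :=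
  fun x => 𝓕⁻ (fun ξ => (mN m₁ N ξ : ℂ) * 𝓕 f ξ) x

/-- The spatial multiplier ⟨∇⟩^s. -/
def japMul (n : ℕ) (s : ℝ) (f : Rn n → ℂ) : Rn n → ℂ :=
  fun x => 𝓕⁻ (fun ξ => ((jap ξ ^ s : ℝ) : ℂ) * 𝓕 f ξ) x

/-- Sharp Littlewood–Paley projection onto {M ≤ ⟨ξ⟩ ≤ 2M}. -/
def LP (n : ℕ) (M : ℝ) (f : Rn n → ℂ) : Rn n → ℂ :=
  fun x => 𝓕⁻ (fun ξ => if M ≤ jap ξ ∧ jap ξ ≤ 2 * M then 𝓕 f ξ else 0) x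

/-- Space-time Fourier transform ψ̃(ξ,τ). -/
def stFourier (n : ℕ) {E : Type*} [NormedAddCommGroup E] [NormedSpace ℂ E]
    (ψ : Rn n → ℝ → E) (ξ : Rn n) (τ : ℝ) : E :=
  ∫ x : Rn n, ∫ t : ℝ,
    Complex.exp (Complex.I * ((-2 * Real.pi * (⟪x, ξ⟫ + t * τ) : ℝ) : ℂ)) • ψ x t

/-- The X_{s,b} norm ‖⟨ξ⟩^s ⟨τ-|ξ|²⟩^b ψ̃‖_{L²}. -/
def XNorm (n : ℕ) {E : Type*} [NormedAddCommGroup E] [NormedSpace ℂ E]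
    (s b : ℝ) (ψ : Rn n → ℝ → E) : ℝ :=
  (∫ ξ : Rn n, ∫ τ : ℝ,
    jap ξ ^ (2 * s) * japR (τ - ‖ξ‖ ^ 2) ^ (2 * b) * ‖stFourier n ψ ξ τ‖ ^ 2) ^ (1/2 : ℝ)

/-- The restricted norm X^δ_{s,b}: infimum over Schwartz extensions off ℝⁿ × [0,δ]. -/
def XRNorm (n : ℕ) {E : Type*} [NormedAddCommGroup E] [NormedSpace ℂ E]
    (s b δ : ℝ) (f : Rn n → ℝ → E) : ℝ :=
  sInf { r : ℝ | ∃ ψ : SchwartzMap (Rn n × ℝ) E,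
    (∀ x : Rn n, ∀ t ∈ Icc (0:ℝ) δ, ψ (x, t) = f x t) ∧
    r = XNorm n s b (fun x t => ψ (x, t)) }

/-- Space-time L^p norm on ℝⁿ × ℝ. -/
def lpNormST (n : ℕ) {E : Type*} [NormedAddCommGroup E] (p : ℝ) (F : Rn n → ℝ → E) : ℝ :=
  (∫ t : ℝ, ∫ x : Rn n, ‖F x t‖ ^ p) ^ (1/p)

/-- Space-time L^p norm on ℝⁿ × [0,δ]. -/
def lpNormSTt (n : ℕ) {E : Type*} [NormedAddCommGroup E] (p δ : ℝ) (F : Rn n → ℝ → E) : ℝ :=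
  (∫ t in Icc (0:ℝ) δ, ∫ x : Rn n, ‖F x t‖ ^ p) ^ (1/p)

section L1L2
variable {V : Type*} [NormedAddCommGroup V] [InnerProductSpace ℝ V] [MeasurableSpace V]
  [BorelSpace V] [FiniteDimensional ℝ V]

theorem integral_fourierInv_mul_eq_of_integrable {f g : V → ℂ} (hf : Integrable f)
    (hg : Integrable g) : ∫ ξ, 𝓕⁻ f ξ * g ξ = ∫ x, f x * 𝓕⁻ g x := by
  have h := VectorFourier.integral_fourierIntegral_smul_eq_flip (μ := volume) (ν := volume)
    (L := -innerₗ V) Real.continuous_fourierChar (by simpa using! continuous_inner.neg) hf hg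
  have hflip : (-innerₗ V).flip = -innerₗ V := by
    ext x y
    simp [real_inner_comm]
  rw [hflip] at h
  exact h

theorem integral_fourier_mul_eq_of_integrable {f g : V → ℂ} (hf : Integrable f)
    (hg : Integrable g) : ∫ ξ, 𝓕 f ξ * g ξ = ∫ x, f x * 𝓕 g x := by
  have h := VectorFourier.integral_fourierIntegral_smul_eq_flip (μ := volume) (ν := volume)
    (L := innerₗ V) Real.continuous_fourierChar (by simpa using! continuous_inner) hf hg
  have hflip : (innerₗ V).flip = innerₗ V := by
    ext x y
    simp
  rw [hflip] at h
  exact h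

theorem continuous_fourierInv_of_integrable {f : V → ℂ} (hf : Integrable f) :
    Continuous (𝓕⁻ f) :=
  VectorFourier.fourierIntegral_continuous (L := -innerₗ V) Real.continuous_fourierChar
    (by simpa using! continuous_inner.neg) hf

theorem norm_fourierInv_le (f : V → ℂ) (v : V) : ‖𝓕⁻ f v‖ ≤ ∫ x, ‖f x‖ :=
  VectorFourier.norm_fourierIntegral_le_integral_norm _ _ _ _ _

/-- On `L¹ ∩ L²` the `L²` inverse Fourier transform is given by the Fourier integral. -/
theorem fourierInv_toLp_ae_eq {f : V → ℂ} (hf : Integrable f) (hf2 : MemLp f 2) :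
    (𝓕⁻ (hf2.toLp f) : Lp ℂ 2 (volume : Measure V)) =ᵐ[volume] 𝓕⁻ f := by
  have hloc : LocallyIntegrable (𝓕⁻ (hf2.toLp f) : Lp ℂ 2 (volume : Measure V)) volume :=
    (Lp.memLp _).locallyIntegrable (by norm_num)
  refine ae_eq_of_integral_contDiff_smul_eq hloc
    (continuous_fourierInv_of_integrable hf).locallyIntegrable fun g hg hgs ↦ ?_
  have hgc : ContDiff ℝ (⊤ : ℕ∞) (fun x ↦ (g x : ℂ)) := ofRealCLM.contDiff.comp hg
  let φ : SchwartzMap V ℂ := HasCompactSupport.toSchwartzMap (hgs.comp_left ofReal_zero) hgc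
  have hφ : ∀ x, φ x = g x := fun x ↦ rfl
  have h := congrArg (fun T ↦ T φ)
    (Lp.fourierInv_toTemperedDistribution_eq (hf2.toLp f))
  simp only [TemperedDistribution.fourierInv_apply, Lp.toTemperedDistribution_apply] at h
  calc ∫ x, g x • (𝓕⁻ (hf2.toLp f) : Lp ℂ 2 (volume : Measure V)) x
      = ∫ x, φ x • (𝓕⁻ (hf2.toLp f) : Lp ℂ 2 (volume : Measure V)) x := by
        simp [hφ]
    _ = ∫ x, (𝓕⁻ φ) x * f x := by
        rw [← h]
        refine integral_congr_ae ?_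
        filter_upwards [hf2.coeFn_toLp] with x hx
        rw [hx, smul_eq_mul]
    _ = ∫ x, φ x * 𝓕⁻ f x := by
        rw [SchwartzMap.fourierInv_coe]
        exact integral_fourierInv_mul_eq_of_integrable φ.integrable hf
    _ = ∫ x, g x • 𝓕⁻ f x := by simp [hφ]

theorem memLp_fourierInv {f : V → ℂ} (hf : Integrable f) (hf2 : MemLp f 2) :
    MemLp (𝓕⁻ f) 2 :=
  (memLp_congr_ae (fourierInv_toLp_ae_eq hf hf2)).1 (Lp.memLp _)

theorem integral_norm_sq_eq_eLpNorm {f : V → ℂ} (hf : MemLp f 2) :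
    ∫ x, ‖f x‖ ^ 2 = (eLpNorm f 2).toReal ^ 2 := by
  rw [hf.eLpNorm_eq_integral_rpow_norm (by norm_num) (by norm_num),
    ENNReal.toReal_ofReal (by positivity)]
  simp only [ENNReal.toReal_ofNat, Real.rpow_ofNat]
  rw [← Real.rpow_natCast, ← Real.rpow_mul (integral_nonneg fun x ↦ by positivity)]
  norm_num

/-- Plancherel's theorem for functions in `L¹ ∩ L²`. -/
theorem integral_norm_sq_fourierInv {f : V → ℂ} (hf : Integrable f) (hf2 : MemLp f 2) :
    ∫ ξ, ‖𝓕⁻ f ξ‖ ^ 2 = ∫ x, ‖f x‖ ^ 2 := by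
  rw [integral_norm_sq_eq_eLpNorm hf2, integral_norm_sq_eq_eLpNorm (memLp_fourierInv hf hf2),
    ← eLpNorm_congr_ae (fourierInv_toLp_ae_eq hf hf2)]
  have h : ‖(𝓕⁻ (hf2.toLp f) : Lp ℂ 2 (volume : Measure V))‖ = ‖hf2.toLp f‖ := by
    rw [← Lp.norm_fourier_eq, FourierTransform.fourier_fourierInv_eq]
  rw [← Lp.norm_def, h, Lp.norm_def, eLpNorm_congr_ae hf2.coeFn_toLp]

theorem fourierInv_char_mul (W : V → ℂ) (v x : V) :
    𝓕⁻ (fun u ↦ (Real.fourierChar (-⟪u, v⟫) : ℂ) * W u) x = 𝓕⁻ W (x - v) := by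
  rw [Real.fourierInv_eq, Real.fourierInv_eq]
  congr 1
  ext u
  simp only [Circle.smul_def, smul_eq_mul, ← mul_assoc, ← Circle.coe_mul, ← AddChar.map_add_eq_mul]
  rw [inner_sub_right, sub_eq_add_neg]

/-- The quadratic form of a Fourier multiplier with bounded kernel is bounded on `L¹`. -/
theorem norm_integral_mul_fourierInv_sq_le {W H : V → ℂ} (hW : Integrable W) (hH : Integrable H)
    {M : ℝ} (hM : ∀ v, ‖𝓕⁻ W v‖ ≤ M) :
    ‖∫ u, W u * (‖𝓕⁻ H u‖ ^ 2 : ℝ)‖ ≤ M * (∫ x, ‖H x‖) ^ 2 := by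
  have hh : Continuous (𝓕⁻ H) := continuous_fourierInv_of_integrable hH
  have hM0 : 0 ≤ M := (norm_nonneg _).trans (hM 0)
  have hWh : Integrable (fun u ↦ W u * 𝓕⁻ H u) :=
    hW.mul_bdd (c := ∫ x, ‖H x‖) hh.aestronglyMeasurable (.of_forall (norm_fourierInv_le H))
  have hHc : Integrable (fun x ↦ (starRingEnd ℂ) (H x)) := by
    refine hH.norm.mono' (continuous_conj.comp_aestronglyMeasurable hH.1) (.of_forall fun x ↦ ?_)
    simp
  have hconj : ∀ u, (starRingEnd ℂ) (𝓕⁻ H u) = 𝓕 (fun x ↦ (starRingEnd ℂ) (H x)) u := by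
    intro u
    rw [Real.fourierInv_eq, Real.fourier_eq, ← integral_conj]
    congr 1
    ext x
    simp [Circle.smul_def, AddChar.map_neg_eq_inv]
  have hpt : ∀ v, ‖𝓕 (fun u ↦ W u * 𝓕⁻ H u) v‖ ≤ M * ∫ x, ‖H x‖ := by
    intro v
    have hWv : Integrable (fun u ↦ (Real.fourierChar (-⟪u, v⟫) : ℂ) * W u) := by
      refine hW.norm.mono' (AEStronglyMeasurable.mul (Continuous.aestronglyMeasurable ?_) hW.1)
        (.of_forall fun x ↦ by rw [norm_mul, Circle.norm_coe, one_mul])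
      fun_prop
    have : 𝓕 (fun u ↦ W u * 𝓕⁻ H u) v = ∫ x, 𝓕⁻ W (x - v) * H x := by
      rw [Real.fourier_eq]
      simp only [← fourierInv_char_mul]
      rw [integral_fourierInv_mul_eq_of_integrable hWv hH]
      congr 1
      ext u
      simp [Circle.smul_def, mul_assoc]
    rw [this, ← integral_const_mul]
    refine norm_integral_le_of_norm_le (hH.norm.const_mul M) (.of_forall fun x ↦ ?_)
    rw [norm_mul]
    gcongr
    exact hM _
  have : ∫ u, W u * (‖𝓕⁻ H u‖ ^ 2 : ℝ)
      = ∫ v, 𝓕 (fun u ↦ W u * 𝓕⁻ H u) v * (starRingEnd ℂ) (H v) := by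
    rw [integral_fourier_mul_eq_of_integrable hWh hHc]
    congr 1
    ext u
    rw [← hconj, mul_assoc, Complex.mul_conj, Complex.normSq_eq_norm_sq]
  rw [this, pow_two, ← mul_assoc, ← integral_const_mul]
  refine norm_integral_le_of_norm_le (hH.norm.const_mul _) (.of_forall fun x ↦ ?_)
  rw [norm_mul, RCLike.norm_conj]
  gcongr
  exact hpt _
end L1L2

theorem abs_cos_sub_one_le (y : ℝ) : |Real.cos y - 1| ≤ 2 * |y| ^ (3 / 2 : ℝ) := by
  rw [abs_sub_comm, abs_of_nonneg (by linarith [Real.cos_le_one y])]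
  rcases le_total |y| 1 with h | h
  · have h1 := Real.one_sub_sq_div_two_le_cos (x := y)
    have h2 : |y| ^ (2 : ℝ) ≤ |y| ^ (3 / 2 : ℝ) :=
      Real.rpow_le_rpow_of_exponent_ge_of_imp (abs_nonneg y) h (by norm_num) (by norm_num)
    rw [Real.rpow_two, sq_abs] at h2
    nlinarith [sq_nonneg y]
  · have h1 : 1 ≤ |y| ^ (3 / 2 : ℝ) := Real.one_le_rpow h (by norm_num)
    linarith [Real.neg_one_le_cos y]

/-- The inverse Fourier transform of an even function with vanishing integral supported in
`[-R, R]` vanishes to order `3 / 2` at the origin. -/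
theorem norm_fourierInv_le_of_even {w : ℝ → ℝ} {R : ℝ} (hw : Integrable w)
    (heven : ∀ σ, w (-σ) = w σ) (hsupp : ∀ σ, R < |σ| → w σ = 0) (hint : ∫ σ, w σ = 0) (t : ℝ) :
    ‖𝓕⁻ (fun σ ↦ (w σ : ℂ)) t‖ ≤ 2 * (2 * Real.pi * |t| * R) ^ (3 / 2 : ℝ) * ∫ σ, |w σ| := by
  have hexp : ∀ s : ℝ, Integrable (fun σ : ℝ ↦ cexp ((2 * Real.pi * (σ * s) : ℝ) * I) * w σ) := by
    intro s
    refine hw.norm.mono' (AEStronglyMeasurable.mul (Continuous.aestronglyMeasurable (by fun_prop))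
      (continuous_ofReal.comp_aestronglyMeasurable hw.1)) (.of_forall fun x ↦ ?_)
    rw [norm_mul, Complex.norm_exp_ofReal_mul_I, one_mul, Complex.norm_real]
  have hF : 𝓕⁻ (fun σ ↦ (w σ : ℂ)) t = ∫ σ : ℝ, cexp ((2 * Real.pi * (σ * t) : ℝ) * I) * w σ := by
    rw [Real.fourierInv_eq']
    simp [mul_comm]
  have hF' : 𝓕⁻ (fun σ ↦ (w σ : ℂ)) t
      = ∫ σ : ℝ, cexp ((2 * Real.pi * (σ * (-t)) : ℝ) * I) * w σ := by
    rw [hF, ← integral_neg_eq_self]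
    simp [heven]
  have hF0 : ∫ σ, (w σ : ℂ) = 0 := by
    rw [← ofReal_zero, ← hint]
    exact integral_ofReal
  have hsum : 𝓕⁻ (fun σ ↦ (w σ : ℂ)) t
      = ∫ σ, (((Real.cos (2 * Real.pi * (σ * t)) - 1) * w σ : ℝ) : ℂ) := by
    have h2 : 2 * 𝓕⁻ (fun σ ↦ (w σ : ℂ)) t
        = ∫ σ, 2 * (((Real.cos (2 * Real.pi * (σ * t)) - 1) * w σ : ℝ) : ℂ) := by
      rw [two_mul]
      nth_rewrite 1 [hF]
      rw [hF', ← integral_add (hexp t) (hexp (-t)), ← sub_zero (∫ _, _ + _),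
        ← mul_zero (2 : ℂ), ← hF0, ← integral_const_mul]
      refine (integral_sub ((hexp t).add (hexp (-t))) (hw.ofReal.const_mul 2)).symm.trans ?_
      congr 1
      ext σ
      have hc : cexp ((2 * Real.pi * (σ * t) : ℝ) * I) + cexp ((2 * Real.pi * (σ * (-t)) : ℝ) * I)
          = 2 * Complex.cos ((2 * Real.pi * (σ * t) : ℝ)) := by
        rw [Complex.two_cos]
        congr 3
        push_cast
        ring
      simp only [ofReal_mul (_ - _), ofReal_sub, ofReal_cos, ofReal_one, Pi.add_apply]
      linear_combination (w σ : ℂ) * hc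
    rw [integral_const_mul] at h2
    exact mul_left_cancel₀ two_ne_zero h2
  rw [hsum, ← integral_const_mul]
  refine norm_integral_le_of_norm_le (hw.abs.const_mul _) (.of_forall fun σ ↦ ?_)
  rw [Complex.norm_real, norm_mul, Real.norm_eq_abs, Real.norm_eq_abs]
  rcases le_or_gt |σ| R with h | h
  · gcongr
    refine (abs_cos_sub_one_le _).trans ?_
    rw [abs_mul, abs_mul σ, abs_of_pos (by positivity : 0 < 2 * Real.pi)]
    gcongr 2 * ?_ ^ _
    rw [mul_assoc _ |t|, mul_comm |σ|]
    gcongr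
  · simp [hsupp σ h]

theorem integrable_gaussian_mul_comp_sub {w : ℝ → ℝ} (hw : Integrable w) (hwm : Measurable w)
    {δ : ℝ} (hδ : 0 < δ) :
    Integrable (fun p : Rn 3 × ℝ ↦ Real.exp (-δ * ‖p.1‖ ^ 2) * w (p.2 - ‖p.1‖ ^ 2)) := by
  have hg : Integrable (fun ξ : Rn 3 ↦ Real.exp (-δ * ‖ξ‖ ^ 2)) := by
    have := GaussianFourier.integrable_cexp_neg_mul_sq_norm_add (V := Rn 3) (b := (δ : ℂ))
      (by simpa using hδ) 0 0
    refine this.norm.congr (.of_forall fun ξ ↦ ?_)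
    simp only [norm_exp]
    congr 1
    simp [← ofReal_pow, ← ofReal_mul, ← ofReal_neg]
  rw [Measure.volume_eq_prod, integrable_prod_iff (by fun_prop)]
  refine ⟨.of_forall fun ξ ↦ (hw.comp_sub_right (‖ξ‖ ^ 2)).const_mul (Real.exp (-δ * ‖ξ‖ ^ 2)), ?_⟩
  simp only [norm_mul]
  refine (hg.mul_const (∫ σ, ‖w σ‖)).congr (.of_forall fun ξ ↦ ?_)
  simp only
  rw [integral_const_mul, integral_sub_right_eq_self (fun σ ↦ ‖w σ‖), Real.norm_eq_abs,
    Real.abs_exp]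

theorem norm_integral_cexp_le {δ t : ℝ} (hδ : 0 < δ) (ht : t ≠ 0) (x : Rn 3) :
    ‖∫ ξ : Rn 3, cexp (-(δ - 2 * Real.pi * t * I) * ‖ξ‖ ^ 2 + (2 * Real.pi * I) * ⟪x, ξ⟫)‖
      ≤ (1 / (2 * |t|)) ^ (3 / 2 : ℝ) := by
  have hre : (δ - 2 * Real.pi * t * I : ℂ).re = δ := by simp
  have hb : 0 < (δ - 2 * Real.pi * t * I : ℂ).re := by rwa [hre]
  have him : (δ - 2 * Real.pi * t * I : ℂ).im = -(2 * Real.pi * t) := by simp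
  set b : ℂ := δ - 2 * Real.pi * t * I with hbdef
  have hb0 : b ≠ 0 := by rintro h; rw [h] at hb; simp at hb
  rw [GaussianFourier.integral_cexp_neg_mul_sq_norm_add hb, norm_mul]
  have h1 : ‖cexp ((2 * Real.pi * I) ^ 2 * ‖x‖ ^ 2 / (4 * b))‖ ≤ 1 := by
    rw [norm_exp, Real.exp_le_one_iff]
    have : (2 * Real.pi * I) ^ 2 * ‖x‖ ^ 2 / (4 * b)
        = ((-(Real.pi ^ 2 * ‖x‖ ^ 2) : ℝ) : ℂ) * b⁻¹ := by
      field_simp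
      push_cast
      ring_nf
      simp
    rw [this, re_ofReal_mul, inv_re]
    have := normSq_nonneg b
    have : 0 ≤ Real.pi ^ 2 * ‖x‖ ^ 2 := by positivity
    have : 0 ≤ b.re / normSq b := by positivity
    nlinarith
  have h2 : ‖((Real.pi : ℂ) / b) ^ (Module.finrank ℝ (Rn 3) / 2 : ℂ)‖
      = (Real.pi / ‖b‖) ^ (3 / 2 : ℝ) := by
    have : (Module.finrank ℝ (Rn 3) / 2 : ℂ) = ((3 / 2 : ℝ) : ℂ) := by simp
    rw [this, Complex.norm_cpow_real, norm_div, Complex.norm_real,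
      Real.norm_of_nonneg Real.pi_nonneg]
  rw [h2]
  refine (mul_le_of_le_one_right (by positivity) h1).trans ?_
  gcongr ?_ ^ _
  have hnb : 2 * Real.pi * |t| ≤ ‖b‖ := by
    have := abs_im_le_norm b
    rwa [him, abs_neg, abs_mul, abs_of_pos (by positivity : 0 < 2 * Real.pi)] at this
  calc Real.pi / ‖b‖ ≤ Real.pi / (2 * Real.pi * |t|) := by
        have := abs_pos.2 ht
        gcongr
    _ = 1 / (2 * |t|) := by
        have := abs_pos.2 ht
        field_simp

/-- Space-time Euclidean space `ℝ³ × ℝ`. -/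
abbrev SpaceTime := WithLp 2 (Rn 3 × ℝ)

theorem integral_spaceTime {E : Type*} [NormedAddCommGroup E] [NormedSpace ℝ E]
    (f : SpaceTime → E) :
    ∫ v, f v = ∫ p : Rn 3 × ℝ, f (WithLp.toLp 2 p) :=
  ((WithLp.volume_preserving_toLp (Rn 3) ℝ).integral_comp
    (MeasurableEquiv.toLp 2 (Rn 3 × ℝ)).measurableEmbedding f).symm

theorem integrable_spaceTime_iff {E : Type*} [NormedAddCommGroup E] {f : SpaceTime → E} :
    Integrable f ↔ Integrable (fun p : Rn 3 × ℝ ↦ f (WithLp.toLp 2 p)) :=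
  ((WithLp.volume_preserving_toLp (Rn 3) ℝ).integrable_comp_emb
    (MeasurableEquiv.toLp 2 (Rn 3 × ℝ)).measurableEmbedding).symm

theorem fourierInv_gaussian_mul_comp_sub {w : ℝ → ℝ} (hw : Integrable w) (hwm : Measurable w)
    {δ : ℝ} (hδ : 0 < δ) (x : Rn 3) (t : ℝ) :
    𝓕⁻ (fun v : SpaceTime ↦ ((Real.exp (-δ * ‖v.fst‖ ^ 2) * w (v.snd - ‖v.fst‖ ^ 2) : ℝ) : ℂ))
        (WithLp.toLp 2 (x, t))
      = 𝓕⁻ (fun σ ↦ (w σ : ℂ)) t *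
        ∫ ξ : Rn 3, cexp (-(δ - 2 * Real.pi * t * I) * ‖ξ‖ ^ 2 + (2 * Real.pi * I) * ⟪x, ξ⟫) := by
  rw [Real.fourierInv_eq', integral_spaceTime, Measure.volume_eq_prod, integral_prod]
  · rw [← integral_const_mul]
    congr 1
    ext ξ
    rw [Real.fourierInv_eq', ← integral_mul_const]
    simp only [smul_eq_mul]
    rw [← integral_add_right_eq_self _ (‖ξ‖ ^ 2)]
    congr 1
    ext τ
    simp only [WithLp.prod_inner_apply, WithLp.toLp_fst, WithLp.toLp_snd,
      add_sub_cancel_right, ofReal_mul, ofReal_exp]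
    rw [← mul_assoc, ← Complex.exp_add]
    conv_rhs => rw [mul_right_comm, ← Complex.exp_add]
    congr 2
    simp [real_inner_comm x ξ]
    ring
  · refine (integrable_gaussian_mul_comp_sub hw hwm hδ).norm.mono' ?_ (.of_forall fun p ↦ ?_)
    · refine AEStronglyMeasurable.mul (Continuous.aestronglyMeasurable ?_) ?_
      · simp only [WithLp.prod_inner_apply]
        fun_prop
      · exact continuous_ofReal.comp_aestronglyMeasurable
          (integrable_gaussian_mul_comp_sub hw hwm hδ).1
    · rw [norm_smul, Complex.norm_exp_ofReal_mul_I, one_mul, Complex.norm_real]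
      rfl

theorem norm_fourierInv_gaussian_mul_comp_sub_le {w : ℝ → ℝ} {R : ℝ} (hR : 0 < R)
    (hw : Integrable w) (hwm : Measurable w)
    (heven : ∀ σ, w (-σ) = w σ) (hsupp : ∀ σ, R < |σ| → w σ = 0) (hint : ∫ σ, w σ = 0)
    {δ : ℝ} (hδ : 0 < δ) (v : SpaceTime) :
    ‖𝓕⁻ (fun v : SpaceTime ↦ ((Real.exp (-δ * ‖v.fst‖ ^ 2) * w (v.snd - ‖v.fst‖ ^ 2) : ℝ) : ℂ)) v‖
      ≤ 2 * (Real.pi * R) ^ (3 / 2 : ℝ) * ∫ σ, |w σ| := by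
  obtain ⟨x, t⟩ := v
  have hw0 : 0 ≤ ∫ σ, |w σ| := integral_nonneg fun _ ↦ abs_nonneg _
  have h1 := norm_fourierInv_le_of_even hw heven hsupp hint t
  rw [fourierInv_gaussian_mul_comp_sub hw hwm hδ, norm_mul]
  rcases eq_or_ne t 0 with rfl | ht
  · have h0 : ‖𝓕⁻ (fun σ ↦ (w σ : ℂ)) 0‖ = 0 := by
      refine le_antisymm (h1.trans ?_) (norm_nonneg _)
      simp
    rw [h0, zero_mul]
    positivity
  · have ht' := abs_pos.2 ht
    calc _ ≤ (2 * (2 * Real.pi * |t| * R) ^ (3 / 2 : ℝ) * ∫ σ, |w σ|)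
            * (1 / (2 * |t|)) ^ (3 / 2 : ℝ) := by
          gcongr
          exact norm_integral_cexp_le hδ ht x
      _ = 2 * ((2 * Real.pi * |t| * R) * (1 / (2 * |t|))) ^ (3 / 2 : ℝ) * ∫ σ, |w σ| := by
          rw [Real.mul_rpow (x := 2 * Real.pi * |t| * R) (by positivity) (by positivity)]
          ring
      _ = _ := by
          congr 3
          field_simp

theorem one_le_japR (x : ℝ) : 1 ≤ japR x := Real.one_le_sqrt.2 (by nlinarith [sq_nonneg x])

theorem japR_pos (x : ℝ) : 0 < japR x := one_pos.trans_le (one_le_japR x)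

theorem abs_le_japR (x : ℝ) : |x| ≤ japR x := Real.abs_le_sqrt (by linarith)

theorem japR_neg (x : ℝ) : japR (-x) = japR x := by simp [japR]

theorem continuous_japR_rpow (s : ℝ) : Continuous fun x ↦ japR x ^ s := by
  refine Continuous.rpow_const ?_ fun x ↦ .inl (japR_pos x).ne'
  unfold japR
  fun_prop

theorem japR_rpow_neg_le {a x : ℝ} (ha : 0 < a) (hx : 0 < |x|) : japR x ^ (-a) ≤ |x| ^ (-a) :=
  Real.rpow_le_rpow_of_nonpos hx (abs_le_japR x) (by linarith)

theorem setIntegral_japR_rpow_le {a R : ℝ} (ha : 0 < a) (ha1 : a < 1) (hR : 0 < R) :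
    ∫ σ in Icc (-R) R, japR σ ^ (-a) ≤ 2 / (1 - a) * R ^ (1 - a) := by
  have hi : ∀ u v : ℝ, IntervalIntegrable (fun σ ↦ japR σ ^ (-a)) volume u v := fun u v ↦
    (continuous_japR_rpow (-a)).intervalIntegrable u v
  have hhalf : ∫ σ in (0 : ℝ)..R, japR σ ^ (-a) ≤ R ^ (1 - a) / (1 - a) := by
    calc ∫ σ in (0 : ℝ)..R, japR σ ^ (-a) ≤ ∫ σ in (0 : ℝ)..R, σ ^ (-a) := by
          refine intervalIntegral.integral_mono_on_of_le_Ioo hR.le (hi _ _)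
            (intervalIntegral.intervalIntegrable_rpow' (by linarith)) fun σ hσ ↦ ?_
          have := japR_rpow_neg_le ha (abs_pos.2 hσ.1.ne')
          rwa [abs_of_pos hσ.1] at this
      _ = R ^ (1 - a) / (1 - a) := by
          rw [integral_rpow (.inl (by linarith)), Real.zero_rpow (by linarith), sub_zero,
            neg_add_eq_sub]
  rw [integral_Icc_eq_integral_Ioc, ← intervalIntegral.integral_of_le (by linarith),
    ← intervalIntegral.integral_add_adjacent_intervals (hi (-R) 0) (hi 0 R)]
  have hneg : ∫ σ in (-R)..0, japR σ ^ (-a) = ∫ σ in (0 : ℝ)..R, japR σ ^ (-a) := by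
    have := intervalIntegral.integral_comp_neg (a := 0) (b := R) fun σ ↦ japR σ ^ (-a)
    simpa only [japR_neg, neg_zero] using this.symm
  rw [hneg]
  calc _ ≤ R ^ (1 - a) / (1 - a) + R ^ (1 - a) / (1 - a) := add_le_add hhalf hhalf
    _ = _ := by ring

/-- The mean of `japR ^ (-a)` over `[-R, R]`. -/
def japRMean (a R : ℝ) : ℝ := (∫ σ in Icc (-R) R, japR σ ^ (-a)) / (2 * R)

/-- The weight `japR ^ (-a)` truncated to `[-R, R]` and normalised to have vanishing integral. -/
def truncWeight (a R : ℝ) : ℝ → ℝ := (Icc (-R) R).indicator fun σ ↦ japR σ ^ (-a) - japRMean a R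

theorem japRMean_nonneg (a : ℝ) {R : ℝ} (hR : 0 < R) : 0 ≤ japRMean a R :=
  div_nonneg (integral_nonneg fun σ ↦ (Real.rpow_pos_of_pos (japR_pos σ) _).le) (by linarith)

theorem japRMean_le {a R : ℝ} (ha : 0 < a) (ha1 : a < 1) (hR : 0 < R) :
    japRMean a R ≤ 1 / (1 - a) * R ^ (-a) := by
  rw [japRMean, div_le_iff₀ (by linarith)]
  refine (setIntegral_japR_rpow_le ha ha1 hR).trans_eq ?_
  rw [sub_eq_neg_add 1 a, Real.rpow_add_one hR.ne']
  ring

theorem integrableOn_japR_rpow (s u v : ℝ) : IntegrableOn (fun σ ↦ japR σ ^ s) (Icc u v) :=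
  (continuous_japR_rpow s).continuousOn.integrableOn_Icc

theorem integrable_truncWeight (a R : ℝ) : Integrable (truncWeight a R) :=
  ((integrableOn_japR_rpow _ _ _).sub (by simp)).integrable_indicator measurableSet_Icc

theorem measurable_truncWeight (a R : ℝ) : Measurable (truncWeight a R) :=
  ((continuous_japR_rpow (-a)).measurable.sub_const _).indicator measurableSet_Icc

theorem truncWeight_neg (a R σ : ℝ) : truncWeight a R (-σ) = truncWeight a R σ := by
  have : -σ ∈ Icc (-R) R ↔ σ ∈ Icc (-R) R := by simp [and_comm, neg_le]
  simp only [truncWeight, indicator, this, japR_neg]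

theorem truncWeight_eq_zero {a R σ : ℝ} (h : R < |σ|) : truncWeight a R σ = 0 :=
  indicator_of_notMem (s := Icc (-R) R) (fun hσ ↦ (abs_le.2 hσ).not_gt h) _

theorem integral_truncWeight (a : ℝ) {R : ℝ} (hR : 0 < R) : ∫ σ, truncWeight a R σ = 0 := by
  rw [truncWeight, integral_indicator measurableSet_Icc,
    integral_sub (integrableOn_japR_rpow _ _ _) (by simp), setIntegral_const, japRMean]
  simp only [measureReal_def, Real.volume_Icc, smul_eq_mul]
  rw [ENNReal.toReal_ofReal (by linarith)]
  field_simp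
  ring

theorem integral_abs_truncWeight_le {a R : ℝ} (ha : 0 < a) (ha1 : a < 1) (hR : 0 < R) :
    ∫ σ, |truncWeight a R σ| ≤ 4 / (1 - a) * R ^ (1 - a) := by
  have h0 := integral_truncWeight a hR
  calc ∫ σ, |truncWeight a R σ|
      ≤ ∫ σ, (2 * (Icc (-R) R).indicator (fun σ ↦ japR σ ^ (-a)) σ - truncWeight a R σ) := by
        refine integral_mono (integrable_truncWeight a R).abs ((Integrable.const_mul
          ((integrableOn_japR_rpow _ _ _).integrable_indicator measurableSet_Icc) 2).sub
          (integrable_truncWeight a R)) fun σ ↦ ?_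
        have hc := japRMean_nonneg a hR
        have hj := (Real.rpow_pos_of_pos (japR_pos σ) (-a)).le
        simp only [truncWeight, indicator]
        split_ifs with h
        · rw [abs_le]
          constructor <;> linarith
        · simp
    _ = 2 * ∫ σ in Icc (-R) R, japR σ ^ (-a) := by
        rw [integral_sub _ (integrable_truncWeight a R), h0, integral_const_mul,
          integral_indicator measurableSet_Icc, sub_zero]
        exact Integrable.const_mul
          ((integrableOn_japR_rpow _ _ _).integrable_indicator measurableSet_Icc) 2
    _ ≤ _ := by
        have := setIntegral_japR_rpow_le ha ha1 hR
        calc _ ≤ 2 * (2 / (1 - a) * R ^ (1 - a)) := by gcongr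
          _ = _ := by ring

theorem japR_rpow_le_truncWeight_add {a R : ℝ} (ha : 0 < a) (ha1 : a < 1) (hR : 0 < R) (σ : ℝ) :
    japR σ ^ (-a) ≤ truncWeight a R σ + (1 / (1 - a) + 1) * R ^ (-a) := by
  have hc := japRMean_le ha ha1 hR
  have hR' := (Real.rpow_pos_of_pos hR (-a)).le
  rw [add_mul, one_mul]
  by_cases h : σ ∈ Icc (-R) R
  · rw [truncWeight, indicator_of_mem h]
    linarith
  · have h' : R < |σ| := not_le.1 fun h' ↦ h (abs_le.1 h')
    rw [truncWeight_eq_zero h']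
    have h1 := japR_rpow_neg_le ha (hR.trans h')
    have h2 := Real.rpow_le_rpow_of_nonpos hR h'.le (by linarith : -a ≤ 0)
    have : 0 ≤ 1 / (1 - a) * R ^ (-a) := mul_nonneg (one_div_nonneg.2 (by linarith)) hR'
    linarith

/-- Restriction-type estimate for the weight `japR ^ (-a)` of the paraboloid. -/
theorem integral_japR_mul_fourierInv_sq_le {a R δ : ℝ} (ha : 0 < a) (ha1 : a < 1) (hR : 0 < R)
    (hδ : 0 < δ) {H : SpaceTime → ℂ} (hH : Integrable H) (hH2 : MemLp H 2) :
    ∫ v : SpaceTime, Real.exp (-δ * ‖v.fst‖ ^ 2) * japR (v.snd - ‖v.fst‖ ^ 2) ^ (-a) *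
        ‖𝓕⁻ H v‖ ^ 2
      ≤ 8 / (1 - a) * Real.pi ^ (3 / 2 : ℝ) * R ^ (5 / 2 - a) * (∫ v, ‖H v‖) ^ 2
        + (1 / (1 - a) + 1) * R ^ (-a) * ∫ v, ‖H v‖ ^ 2 := by
  set K : ℝ := (1 / (1 - a) + 1) * R ^ (-a)
  have hK0 : 0 ≤ K := by
    have : 0 < 1 - a := by linarith
    positivity
  set W : SpaceTime → ℝ := fun v ↦
    Real.exp (-δ * ‖v.fst‖ ^ 2) * truncWeight a R (v.snd - ‖v.fst‖ ^ 2)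
  have hW : Integrable W := integrable_spaceTime_iff.2
    (integrable_gaussian_mul_comp_sub (integrable_truncWeight a R) (measurable_truncWeight a R) hδ)
  have hsq : Integrable (fun v ↦ ‖𝓕⁻ H v‖ ^ 2) :=
    (memLp_fourierInv hH hH2).integrable_norm_pow two_ne_zero
  have hWsq : Integrable (fun v ↦ W v * ‖𝓕⁻ H v‖ ^ 2) := by
    refine hW.mul_bdd (c := (∫ x, ‖H x‖) ^ 2)
      ((continuous_fourierInv_of_integrable hH).norm.pow 2).aestronglyMeasurable
      (.of_forall fun v ↦ ?_)
    rw [norm_pow, norm_norm]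
    gcongr
    exact norm_fourierInv_le H v
  have h1 : ∫ v, W v * ‖𝓕⁻ H v‖ ^ 2
      ≤ 8 / (1 - a) * Real.pi ^ (3 / 2 : ℝ) * R ^ (5 / 2 - a) * (∫ v, ‖H v‖) ^ 2 := by
    have hWc : Integrable (fun v ↦ (W v : ℂ)) := hW.ofReal
    have h := norm_integral_mul_fourierInv_sq_le hWc hH
      (norm_fourierInv_gaussian_mul_comp_sub_le hR (integrable_truncWeight a R)
        (measurable_truncWeight a R) (truncWeight_neg a R) (fun _ ↦ truncWeight_eq_zero)
        (integral_truncWeight a hR) hδ)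
    simp only [← ofReal_mul] at h
    rw [integral_complex_ofReal, Complex.norm_real] at h
    refine (le_abs_self _).trans (h.trans (mul_le_mul_of_nonneg_right ?_ (sq_nonneg _)))
    calc _ ≤ 2 * (Real.pi * R) ^ (3 / 2 : ℝ) * (4 / (1 - a) * R ^ (1 - a)) := by
          gcongr
          exact integral_abs_truncWeight_le ha ha1 hR
      _ = _ := by
          rw [Real.mul_rpow Real.pi_pos.le hR.le, show 5 / 2 - a = 3 / 2 + (1 - a) by ring,
            Real.rpow_add hR]
          ring
  calc _ ≤ ∫ v, (W v * ‖𝓕⁻ H v‖ ^ 2 + K * ‖𝓕⁻ H v‖ ^ 2) := by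
        refine integral_mono_of_nonneg (.of_forall fun v ↦ ?_) (hWsq.add (hsq.const_mul K))
          (.of_forall fun v ↦ ?_)
        · have := japR_pos (v.snd - ‖v.fst‖ ^ 2)
          positivity
        · simp only [← add_mul]
          gcongr
          have h2 := japR_rpow_le_truncWeight_add ha ha1 hR (v.snd - ‖v.fst‖ ^ 2)
          have h3 : Real.exp (-δ * ‖v.fst‖ ^ 2) ≤ 1 := by
            rw [Real.exp_le_one_iff]
            nlinarith [sq_nonneg ‖v.fst‖]
          calc _ ≤ Real.exp (-δ * ‖v.fst‖ ^ 2) * (truncWeight a R (v.snd - ‖v.fst‖ ^ 2) + K) := by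
                gcongr
            _ ≤ _ := by
                rw [mul_add]
                gcongr
                exact mul_le_of_le_one_left hK0 h3
    _ ≤ _ := by
        rw [integral_add hWsq (hsq.const_mul K), integral_const_mul,
          integral_norm_sq_fourierInv hH hH2]
        gcongr

open Filter Topology

theorem integral_japR_mul_fourierInv_sq_le_of_integrable {a R : ℝ} (ha : 0 < a) (ha1 : a < 1)
    (hR : 0 < R) {H : SpaceTime → ℂ} (hH : Integrable H) (hH2 : MemLp H 2) :
    ∫ v : SpaceTime, japR (v.snd - ‖v.fst‖ ^ 2) ^ (-a) * ‖𝓕⁻ H v‖ ^ 2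
      ≤ 8 / (1 - a) * Real.pi ^ (3 / 2 : ℝ) * R ^ (5 / 2 - a) * (∫ v, ‖H v‖) ^ 2
        + (1 / (1 - a) + 1) * R ^ (-a) * ∫ v, ‖H v‖ ^ 2 := by
  have hcont := continuous_fourierInv_of_integrable hH
  have hj := continuous_japR_rpow (-a)
  have hlim : Tendsto (fun δ : ℝ ↦ ∫ v : SpaceTime, Real.exp (-δ * ‖v.fst‖ ^ 2) *
      japR (v.snd - ‖v.fst‖ ^ 2) ^ (-a) * ‖𝓕⁻ H v‖ ^ 2) (𝓝[>] 0)
      (𝓝 (∫ v : SpaceTime, japR (v.snd - ‖v.fst‖ ^ 2) ^ (-a) * ‖𝓕⁻ H v‖ ^ 2)) := by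
    refine tendsto_integral_filter_of_dominated_convergence (fun v ↦ ‖𝓕⁻ H v‖ ^ 2)
      (.of_forall fun δ ↦ ?_) ?_ ((memLp_fourierInv hH hH2).integrable_norm_pow two_ne_zero)
      (.of_forall fun v ↦ ?_)
    · have : Continuous fun v : SpaceTime ↦ japR (v.snd - ‖v.fst‖ ^ 2) ^ (-a) :=
        hj.comp (by fun_prop)
      exact (Continuous.mul (.mul (by fun_prop) this) (hcont.norm.pow 2)).aestronglyMeasurable
    · filter_upwards [self_mem_nhdsWithin] with δ hδ
      refine .of_forall fun v ↦ ?_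
      have h1 : Real.exp (-δ * ‖v.fst‖ ^ 2) ≤ 1 := by
        rw [Real.exp_le_one_iff]
        nlinarith [sq_nonneg ‖v.fst‖, mem_Ioi.1 hδ]
      have h2 : japR (v.snd - ‖v.fst‖ ^ 2) ^ (-a) ≤ 1 :=
        Real.rpow_le_one_of_one_le_of_nonpos (one_le_japR _) (by linarith)
      have h3 := (Real.rpow_pos_of_pos (japR_pos (v.snd - ‖v.fst‖ ^ 2)) (-a)).le
      rw [Real.norm_of_nonneg (by positivity)]
      exact mul_le_of_le_one_left (by positivity) (mul_le_one₀ h1 h3 h2)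
    · have : Tendsto (fun δ : ℝ ↦ Real.exp (-δ * ‖v.fst‖ ^ 2) *
          japR (v.snd - ‖v.fst‖ ^ 2) ^ (-a) * ‖𝓕⁻ H v‖ ^ 2) (𝓝 0)
          (𝓝 (Real.exp (-0 * ‖v.fst‖ ^ 2) *
          japR (v.snd - ‖v.fst‖ ^ 2) ^ (-a) * ‖𝓕⁻ H v‖ ^ 2)) :=
        Continuous.tendsto (by fun_prop) 0
      simp only [neg_zero, zero_mul, Real.exp_zero, one_mul] at this
      exact this.mono_left nhdsWithin_le_nhds
  refine le_of_tendsto hlim ?_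
  filter_upwards [self_mem_nhdsWithin] with δ hδ
  exact integral_japR_mul_fourierInv_sq_le ha ha1 hR hδ hH hH2

theorem integral_mul_sq_le {α : Type*} [MeasurableSpace α] {μ : Measure α} {f g : α → ℝ}
    (hf0 : ∀ x, 0 ≤ f x) (hg0 : ∀ x, 0 ≤ g x) (hf : MemLp f 2 μ) (hg : MemLp g 2 μ) :
    (∫ x, f x * g x ∂μ) ^ 2 ≤ (∫ x, f x ^ 2 ∂μ) * ∫ x, g x ^ 2 ∂μ := by
  have h := integral_mul_le_Lp_mul_Lq_of_nonneg Real.HolderConjugate.two_two (μ := μ)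
    (.of_forall hf0) (.of_forall hg0) (by simpa using hf) (by simpa using hg)
  simp only [Real.rpow_two, ← Real.sqrt_eq_rpow] at h
  calc _ ≤ (√(∫ x, f x ^ 2 ∂μ) * √(∫ x, g x ^ 2 ∂μ)) ^ 2 := by
        gcongr
        exact integral_nonneg fun x ↦ mul_nonneg (hf0 x) (hg0 x)
    _ = _ := by
        rw [mul_pow, Real.sq_sqrt (integral_nonneg fun x ↦ sq_nonneg _),
          Real.sq_sqrt (integral_nonneg fun x ↦ sq_nonneg _)]

theorem integrable_japR_rpow_mul_norm_sq (Φ : SchwartzMap SpaceTime ℂ) {s : ℝ} (hs1 : s ≤ 1) :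
    Integrable fun v : SpaceTime ↦ japR (v.snd - ‖v.fst‖ ^ 2) ^ s * ‖Φ v‖ ^ 2 := by
  obtain ⟨C, hC⟩ := Φ.toBoundedContinuousFunction.isBounded_range.exists_norm_le
  have hC' : ∀ v, ‖Φ v‖ ≤ C := fun v ↦ hC _ ⟨v, rfl⟩
  have hbound : Integrable fun v : SpaceTime ↦
      C * (‖v‖ ^ 0 * ‖Φ v‖ + ‖v‖ ^ 1 * ‖Φ v‖ + ‖v‖ ^ 2 * ‖Φ v‖) :=
    (((Φ.integrable_pow_mul volume 0).add (Φ.integrable_pow_mul volume 1)).add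
      (Φ.integrable_pow_mul volume 2)).const_mul C
  have hj : Continuous fun v : SpaceTime ↦ japR (v.snd - ‖v.fst‖ ^ 2) ^ s :=
    (continuous_japR_rpow s).comp (by fun_prop)
  refine hbound.mono' (hj.mul (Φ.continuous.norm.pow 2)).aestronglyMeasurable
    (.of_forall fun v ↦ ?_)
  have h3 := (Real.rpow_pos_of_pos (japR_pos (v.snd - ‖v.fst‖ ^ 2)) s).le
  have h4 : japR (v.snd - ‖v.fst‖ ^ 2) ^ s ≤ 1 + ‖v‖ + ‖v‖ ^ 2 := by
    have h5 : japR (v.snd - ‖v.fst‖ ^ 2) ^ s ≤ japR (v.snd - ‖v.fst‖ ^ 2) ^ (1 : ℝ) :=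
      Real.rpow_le_rpow_of_exponent_le (one_le_japR _) hs1
    have h6 : japR (v.snd - ‖v.fst‖ ^ 2) ≤ 1 + |v.snd - ‖v.fst‖ ^ 2| := by
      refine Real.sqrt_le_iff.2 ⟨by positivity, ?_⟩
      rw [← sq_abs (v.snd - ‖v.fst‖ ^ 2)]
      nlinarith [abs_nonneg (v.snd - ‖v.fst‖ ^ 2)]
    have h7 : |v.snd - ‖v.fst‖ ^ 2| ≤ |v.snd| + ‖v.fst‖ ^ 2 := by
      refine (abs_sub _ _).trans_eq ?_
      rw [abs_of_nonneg (sq_nonneg ‖v.fst‖)]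
    have h8 := WithLp.norm_fst_le (p := 2) (x := v)
    have h9 : |v.snd| ≤ ‖v‖ := WithLp.norm_snd_le (p := 2) (x := v)
    rw [Real.rpow_one] at h5
    nlinarith [norm_nonneg v.fst]
  rw [Real.norm_of_nonneg (by positivity)]
  calc _ ≤ (1 + ‖v‖ + ‖v‖ ^ 2) * (C * ‖Φ v‖) := by
        rw [pow_two ‖Φ v‖]
        gcongr
        exact hC' v
    _ = _ := by ring

theorem norm_integral_mul_sq_le {a R : ℝ} (ha : 0 < a) (ha1 : a < 1) (hR : 0 < R)
    (Ψ : SchwartzMap SpaceTime ℂ) {H : SpaceTime → ℂ} (hH : Integrable H) (hH2 : MemLp H 2) :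
    ‖∫ v, Ψ v * H v‖ ^ 2
      ≤ (∫ v : SpaceTime, japR (v.snd - ‖v.fst‖ ^ 2) ^ a * ‖𝓕 ⇑Ψ v‖ ^ 2) *
        (8 / (1 - a) * Real.pi ^ (3 / 2 : ℝ) * R ^ (5 / 2 - a) * (∫ v, ‖H v‖) ^ 2
        + (1 / (1 - a) + 1) * R ^ (-a) * ∫ v, ‖H v‖ ^ 2) := by
  rw [← SchwartzMap.fourier_coe]
  set Φ : SchwartzMap SpaceTime ℂ := 𝓕 Ψ
  have hflip : ∫ v, Ψ v * H v = ∫ v, Φ v * 𝓕⁻ H v := by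
    have h1 : ⇑Ψ = 𝓕⁻ ⇑Φ := by
      rw [← SchwartzMap.fourierInv_coe, FourierTransform.fourierInv_fourier_eq]
    nth_rewrite 1 [h1]
    exact integral_fourierInv_mul_eq_of_integrable Φ.integrable hH
  have hjc : ∀ s : ℝ, Continuous fun v : SpaceTime ↦ japR (v.snd - ‖v.fst‖ ^ 2) ^ s := by
    intro s
    exact (continuous_japR_rpow s).comp (by fun_prop)
  have hjpos : ∀ (s : ℝ) (v : SpaceTime), 0 < japR (v.snd - ‖v.fst‖ ^ 2) ^ s := fun s v ↦
    Real.rpow_pos_of_pos (japR_pos _) s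
  have hjsq : ∀ (s : ℝ) (v : SpaceTime), (japR (v.snd - ‖v.fst‖ ^ 2) ^ (s / 2)) ^ 2
      = japR (v.snd - ‖v.fst‖ ^ 2) ^ s := fun s v ↦ by
    rw [← Real.rpow_natCast, ← Real.rpow_mul (japR_pos _).le]
    norm_num
  set f : SpaceTime → ℝ := fun v ↦ japR (v.snd - ‖v.fst‖ ^ 2) ^ (a / 2) * ‖Φ v‖
  set g : SpaceTime → ℝ := fun v ↦ japR (v.snd - ‖v.fst‖ ^ 2) ^ (-a / 2) * ‖𝓕⁻ H v‖
  have hf2 : ∀ v, f v ^ 2 = japR (v.snd - ‖v.fst‖ ^ 2) ^ a * ‖Φ v‖ ^ 2 := fun v ↦ by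
    simp only [f, mul_pow, hjsq]
  have hg2 : ∀ v, g v ^ 2 = japR (v.snd - ‖v.fst‖ ^ 2) ^ (-a) * ‖𝓕⁻ H v‖ ^ 2 := fun v ↦ by
    simp only [g, mul_pow, hjsq]
  have hf : MemLp f 2 := by
    have hfc : Continuous f := (hjc _).mul Φ.continuous.norm
    refine (memLp_two_iff_integrable_sq hfc.aestronglyMeasurable).2 ?_
    simp only [hf2]
    exact integrable_japR_rpow_mul_norm_sq _ ha1.le
  have hg : MemLp g 2 := by
    have hgc : Continuous g := (hjc _).mul (continuous_fourierInv_of_integrable hH).norm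
    refine (memLp_fourierInv hH hH2).mono hgc.aestronglyMeasurable (.of_forall fun v ↦ ?_)
    rw [norm_mul, norm_norm, Real.norm_of_nonneg (hjpos _ _).le]
    exact mul_le_of_le_one_left (norm_nonneg _)
      (Real.rpow_le_one_of_one_le_of_nonpos (one_le_japR _) (by linarith))
  have hfg : ∀ v, ‖Φ v * 𝓕⁻ H v‖ = f v * g v := fun v ↦ by
    have : japR (v.snd - ‖v.fst‖ ^ 2) ^ (a / 2) * japR (v.snd - ‖v.fst‖ ^ 2) ^ (-a / 2) = 1 := by
      rw [← Real.rpow_add (japR_pos _)]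
      simp [neg_div]
    rw [norm_mul]
    linear_combination -(‖Φ v‖ * ‖𝓕⁻ H v‖) * this
  calc ‖∫ v, Ψ v * H v‖ ^ 2 ≤ (∫ v, f v * g v) ^ 2 := by
        rw [hflip]
        simp only [← hfg]
        gcongr
        exact norm_integral_le_integral_norm _
    _ ≤ (∫ v, f v ^ 2) * ∫ v, g v ^ 2 :=
        integral_mul_sq_le (fun v ↦ mul_nonneg (hjpos _ v).le (norm_nonneg _))
          (fun v ↦ mul_nonneg (hjpos _ v).le (norm_nonneg _)) hf hg
    _ ≤ _ := by
        simp only [hf2, hg2]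
        gcongr
        · exact integral_nonneg fun v ↦ mul_nonneg (hjpos a v).le (sq_nonneg _)
        · exact integral_japR_mul_fourierInv_sq_le_of_integrable ha ha1 hR hH hH2

/-- Self-improving bound for the measure of the superlevel sets of a Schwartz function. -/
theorem sq_mul_volume_real_sq_le {a R l : ℝ} (ha : 0 < a) (ha1 : a < 1) (hR : 0 < R) (hl : 0 < l)
    (Ψ : SchwartzMap SpaceTime ℂ) :
    l ^ 2 * volume.real {v | l < ‖Ψ v‖} ^ 2
      ≤ (∫ v : SpaceTime, japR (v.snd - ‖v.fst‖ ^ 2) ^ a * ‖𝓕 ⇑Ψ v‖ ^ 2) *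
        (8 / (1 - a) * Real.pi ^ (3 / 2 : ℝ) * R ^ (5 / 2 - a) * volume.real {v | l < ‖Ψ v‖} ^ 2
        + (1 / (1 - a) + 1) * R ^ (-a) * volume.real {v | l < ‖Ψ v‖}) := by
  set E : Set SpaceTime := {v | l < ‖Ψ v‖}
  have hE : MeasurableSet E := (isOpen_lt continuous_const Ψ.continuous.norm).measurableSet
  have hEfin : volume E ≠ ⊤ :=
    (Integrable.measure_norm_gt_lt_top Ψ.integrable hl).ne
  set H : SpaceTime → ℂ := E.indicator fun v ↦ (starRingEnd ℂ) (Ψ v) / ‖Ψ v‖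
  have hΨ : ∀ v ∈ E, ‖Ψ v‖ ≠ 0 := fun v hv ↦ (hl.trans hv).ne'
  have hnorm : ∀ v, ‖H v‖ = E.indicator 1 v := fun v ↦ by
    by_cases hv : v ∈ E
    · simp [H, hv, hΨ v hv, div_self]
    · simp [H, hv]
  have hmeas : AEStronglyMeasurable H volume :=
    (((continuous_conj.comp Ψ.continuous).measurable.div
      (continuous_ofReal.comp Ψ.continuous.norm).measurable).indicator hE).aestronglyMeasurable
  have hH : ∀ p, MemLp H p := fun p ↦ by
    refine (memLp_indicator_const p hE (1 : ℝ) (.inr hEfin)).mono hmeas (.of_forall fun v ↦ ?_)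
    rw [hnorm]
    exact le_abs_self _
  have h1 : ∫ v, ‖H v‖ = volume.real E := by
    simp only [hnorm]
    rw [integral_indicator_one hE]
  have h2 : ∫ v, ‖H v‖ ^ 2 = volume.real E := by
    rw [← h1]
    congr 1
    ext v
    rw [hnorm]
    by_cases hv : v ∈ E <;> simp [hv]
  have h3 : l * volume.real E ≤ ‖∫ v, Ψ v * H v‖ := by
    have h4 : ∀ v, Ψ v * H v = ((E.indicator (fun v ↦ ‖Ψ v‖) v : ℝ) : ℂ) := fun v ↦ by
      by_cases hv : v ∈ E
      · have := hΨ v hv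
        simp only [H, hv, indicator_of_mem]
        rw [← mul_div_assoc, Complex.mul_conj, Complex.normSq_eq_norm_sq, pow_two, ofReal_mul,
          mul_div_cancel_right₀ _ (ofReal_ne_zero.2 this)]
      · simp [H, hv]
    simp only [h4]
    rw [integral_complex_ofReal, Complex.norm_real, integral_indicator hE]
    refine le_trans ?_ (le_abs_self _)
    rw [mul_comm, ← smul_eq_mul, ← setIntegral_const]
    exact setIntegral_mono_on (integrableOn_const hEfin) Ψ.integrable.norm.integrableOn hE
      fun v hv ↦ (le_of_lt hv)
  have := norm_integral_mul_sq_le ha ha1 hR Ψ (memLp_one_iff_integrable.1 (hH 1)) (hH 2)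
  rw [h1, h2] at this
  refine le_trans ?_ this
  rw [← mul_pow]
  gcongr

theorem exists_volume_real_norm_gt_le : ∃ K > (0 : ℝ), ∀ (Ψ : SchwartzMap SpaceTime ℂ) (X l : ℝ),
    0 < X → 0 < l →
    ∫ v : SpaceTime, japR (v.snd - ‖v.fst‖ ^ 2) ^ (9 / 10 : ℝ) * ‖𝓕 ⇑Ψ v‖ ^ 2 ≤ X ^ 2 →
    volume.real {v | l < ‖Ψ v‖} ≤ K * (l / X) ^ (-(25 / 8) : ℝ) := by
  set A : ℝ := 8 / (1 - 9 / 10) * Real.pi ^ (3 / 2 : ℝ)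
  have hA : 0 < A := by positivity
  refine ⟨22 * (2 * A) ^ (9 / 16 : ℝ), by positivity, fun Ψ X l hX hl hS ↦ ?_⟩
  set m := volume.real {v | l < ‖Ψ v‖}
  have hm : 0 ≤ m := measureReal_nonneg
  rcases hm.eq_or_lt with hm0 | hm0
  · rw [← hm0]
    positivity
  set u := l / X
  have hu : 0 < u := by positivity
  have hlu : l = u * X := by simp only [u]; field_simp
  set R : ℝ := (u ^ 2 / (2 * A)) ^ (5 / 8 : ℝ)
  have hR : 0 < R := by positivity
  have hR1 : R ^ (5 / 2 - 9 / 10 : ℝ) = u ^ 2 / (2 * A) := by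
    rw [← Real.rpow_mul (by positivity)]
    norm_num
  have hR2 : R ^ (-(9 / 10) : ℝ) = u ^ (-(9 / 8) : ℝ) * (2 * A) ^ (9 / 16 : ℝ) := by
    rw [← Real.rpow_mul (by positivity), Real.div_rpow (by positivity) (by positivity),
      ← Real.rpow_natCast, ← Real.rpow_mul hu.le, div_eq_mul_inv, ← Real.rpow_neg (by positivity)]
    norm_num
  have h := sq_mul_volume_real_sq_le (a := 9 / 10) (by norm_num) (by norm_num) hR hl Ψ
  have h2 : l ^ 2 * m ^ 2 ≤ X ^ 2 * (A * (u ^ 2 / (2 * A)) * m ^ 2 +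
      11 * (u ^ (-(9 / 8) : ℝ) * (2 * A) ^ (9 / 16 : ℝ)) * m) := by
    refine h.trans ?_
    rw [hR1, hR2, show (1 / (1 - 9 / 10) + 1 : ℝ) = 11 by norm_num]
    exact mul_le_mul_of_nonneg_right hS (by positivity)
  have h3 : A * (u ^ 2 / (2 * A)) = u ^ 2 / 2 := by field_simp
  rw [h3, hlu] at h2
  have h4 : u ^ 2 * m ≤ 22 * (u ^ (-(9 / 8) : ℝ) * (2 * A) ^ (9 / 16 : ℝ)) := by
    have h5 : (X ^ 2 * m) * (u ^ 2 * m) ≤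
        (X ^ 2 * m) * (22 * (u ^ (-(9 / 8) : ℝ) * (2 * A) ^ (9 / 16 : ℝ))) := by nlinarith
    exact le_of_mul_le_mul_left h5 (by positivity)
  have h6 : u ^ (-(9 / 8) : ℝ) = u ^ 2 * u ^ (-(25 / 8) : ℝ) := by
    rw [← Real.rpow_natCast, ← Real.rpow_add hu]
    norm_num
  rw [h6] at h4
  refine le_of_mul_le_mul_left (h4.trans_eq ?_) (by positivity : 0 < u ^ 2)
  ring

theorem sq_mul_volume_real_norm_gt_le (Ψ : SchwartzMap SpaceTime ℂ) {l : ℝ} (hl : 0 < l) :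
    l ^ 2 * volume.real {v | l < ‖Ψ v‖} ≤
      ∫ v : SpaceTime, japR (v.snd - ‖v.fst‖ ^ 2) ^ (9 / 10 : ℝ) * ‖𝓕 ⇑Ψ v‖ ^ 2 := by
  have hsq : ∀ Φ : SchwartzMap SpaceTime ℂ, Integrable fun v ↦ ‖Φ v‖ ^ 2 := fun Φ ↦
    (Φ.memLp 2).integrable_norm_pow two_ne_zero
  calc l ^ 2 * volume.real {v | l < ‖Ψ v‖} ≤ l ^ 2 * volume.real {v | l ^ 2 ≤ ‖Ψ v‖ ^ 2} := by
        gcongr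
        · exact ((hsq Ψ).measure_ge_lt_top (by positivity)).ne
        · intro h
          gcongr
    _ ≤ ∫ v, ‖Ψ v‖ ^ 2 :=
        mul_meas_ge_le_integral_of_nonneg (.of_forall fun v ↦ sq_nonneg _) (hsq Ψ) _
    _ = ∫ v, ‖𝓕 ⇑Ψ v‖ ^ 2 := by
        rw [← SchwartzMap.fourier_coe, SchwartzMap.integral_norm_sq_fourier]
    _ ≤ _ := by
        rw [← SchwartzMap.fourier_coe]
        refine integral_mono (hsq _) (integrable_japR_rpow_mul_norm_sq _ (by norm_num)) fun v ↦ ?_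
        exact le_mul_of_one_le_left (sq_nonneg _)
          (Real.one_le_rpow (one_le_japR _) (by norm_num))

theorem lintegral_Ioi_rpow_div_le {X : ℝ} (hX : 0 < X) :
    ∫⁻ l in Ioi X, ENNReal.ofReal (X ^ 2 * (l / X) ^ (-(9 / 8) : ℝ))
      = ENNReal.ofReal (8 * X ^ 3) := by
  have hi : IntegrableOn (fun l : ℝ ↦ l ^ (-(9 / 8) : ℝ)) (Ioi X) :=
    integrableOn_Ioi_rpow_of_lt (by norm_num) hX
  have heq : ∀ l ∈ Ioi X, X ^ 2 * (l / X) ^ (-(9 / 8) : ℝ)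
      = X ^ 2 * X ^ (9 / 8 : ℝ) * l ^ (-(9 / 8) : ℝ) := fun l hl ↦ by
    rw [Real.div_rpow (hX.trans hl).le hX.le, div_eq_mul_inv, ← Real.rpow_neg hX.le, neg_neg]
    ring
  rw [setLIntegral_congr_fun measurableSet_Ioi fun l hl ↦ congrArg _ (heq l hl),
    ← ofReal_integral_eq_lintegral_ofReal (hi.const_mul _), integral_const_mul,
    integral_Ioi_rpow_of_lt (by norm_num) hX]
  · congr 1
    have : X = X ^ (9 / 8 : ℝ) * X ^ (-(9 / 8) + 1 : ℝ) := by
      rw [← Real.rpow_add hX]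
      norm_num
    calc _ = 8 * X ^ 2 * (X ^ (9 / 8 : ℝ) * X ^ (-(9 / 8) + 1 : ℝ)) := by ring
      _ = _ := by
        rw [← this]
        ring
  · filter_upwards [ae_restrict_mem measurableSet_Ioi] with l hl
    have : 0 < l := hX.trans hl
    positivity

theorem exists_integral_norm_cube_le_of_pos :
    ∃ K > (0 : ℝ), ∀ (Ψ : SchwartzMap SpaceTime ℂ) (X : ℝ),
    0 < X → ∫ v : SpaceTime, japR (v.snd - ‖v.fst‖ ^ 2) ^ (9 / 10 : ℝ) * ‖𝓕 ⇑Ψ v‖ ^ 2 ≤ X ^ 2 →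
    ∫ v, ‖Ψ v‖ ^ (3 : ℝ) ≤ K * X ^ 3 := by
  obtain ⟨K, hK, hvol⟩ := exists_volume_real_norm_gt_le
  refine ⟨3 * (1 + K * 8), by positivity, fun Ψ X hX hS ↦ ?_⟩
  have hfin : ∀ l : ℝ, 0 < l → volume {v | l < ‖Ψ v‖} ≠ ⊤ := fun l hl ↦
    (Integrable.measure_norm_gt_lt_top Ψ.integrable hl).ne
  have hterm : ∀ l : ℝ, 0 < l → volume {v | l < ‖Ψ v‖} * ENNReal.ofReal (l ^ (3 - 1 : ℝ))
      = ENNReal.ofReal (l ^ 2 * volume.real {v | l < ‖Ψ v‖}) := fun l hl ↦ by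
    rw [← ofReal_measureReal (hfin l hl), ← ENNReal.ofReal_mul measureReal_nonneg, mul_comm]
    norm_num
  have hlow : ∫⁻ l in Ioc 0 X, volume {v | l < ‖Ψ v‖} * ENNReal.ofReal (l ^ (3 - 1 : ℝ))
      ≤ ENNReal.ofReal (X ^ 3) := by
    calc _ ≤ ∫⁻ l in Ioc 0 X, ENNReal.ofReal (X ^ 2) := by
          refine setLIntegral_mono' measurableSet_Ioc fun l hl ↦ ?_
          rw [hterm l hl.1]
          exact ENNReal.ofReal_le_ofReal ((sq_mul_volume_real_norm_gt_le Ψ hl.1).trans hS)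
      _ = _ := by
          rw [setLIntegral_const, Real.volume_Ioc, ← ENNReal.ofReal_mul (by positivity), sub_zero,
            ← pow_succ]
  have hhigh : ∫⁻ l in Ioi X, volume {v | l < ‖Ψ v‖} * ENNReal.ofReal (l ^ (3 - 1 : ℝ))
      ≤ ENNReal.ofReal K * ENNReal.ofReal (8 * X ^ 3) := by
    rw [← lintegral_Ioi_rpow_div_le hX, ← lintegral_const_mul' _ _ ENNReal.ofReal_ne_top]
    refine setLIntegral_mono' measurableSet_Ioi fun l hl ↦ ?_
    have hl0 : 0 < l := hX.trans hl
    have hu : 0 < l / X := by positivity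
    rw [hterm l hl0, ← ENNReal.ofReal_mul hK.le]
    refine ENNReal.ofReal_le_ofReal ?_
    calc _ ≤ l ^ 2 * (K * (l / X) ^ (-(25 / 8) : ℝ)) := by
          gcongr
          exact hvol Ψ X l hX hl0 hS
      _ = K * (X ^ 2 * ((l / X) ^ 2 * (l / X) ^ (-(25 / 8) : ℝ))) := by
          field_simp
      _ = _ := by
          rw [← Real.rpow_natCast (l / X), ← Real.rpow_add hu]
          norm_num
  rw [integral_eq_lintegral_of_nonneg_ae (.of_forall fun v ↦ by positivity)
    (Continuous.aestronglyMeasurable (Ψ.continuous.norm.rpow_const fun _ ↦ .inr (by norm_num)))]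
  refine ENNReal.toReal_le_of_le_ofReal (by positivity) ?_
  rw [lintegral_rpow_eq_lintegral_meas_lt_mul volume (.of_forall fun v ↦ norm_nonneg _)
    Ψ.continuous.norm.aemeasurable (by norm_num), ← Ioc_union_Ioi_eq_Ioi hX.le,
    lintegral_union measurableSet_Ioi (Set.Ioc_disjoint_Ioi le_rfl)]
  calc _ ≤ ENNReal.ofReal 3 * (ENNReal.ofReal (X ^ 3) +
        ENNReal.ofReal K * ENNReal.ofReal (8 * X ^ 3)) := by gcongr
    _ = _ := by
        rw [← ENNReal.ofReal_mul hK.le, ← ENNReal.ofReal_add (by positivity) (by positivity),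
          ← ENNReal.ofReal_mul (by norm_num)]
        congr 1
        ring

theorem exists_integral_norm_cube_le : ∃ K > (0 : ℝ), ∀ Ψ : SchwartzMap SpaceTime ℂ,
    ∫ v, ‖Ψ v‖ ^ (3 : ℝ) ≤ K *
      √(∫ v : SpaceTime, japR (v.snd - ‖v.fst‖ ^ 2) ^ (9 / 10 : ℝ) * ‖𝓕 ⇑Ψ v‖ ^ 2) ^ 3 := by
  obtain ⟨K, hK, h⟩ := exists_integral_norm_cube_le_of_pos
  refine ⟨K, hK, fun Ψ ↦ ?_⟩
  set S := ∫ v : SpaceTime, japR (v.snd - ‖v.fst‖ ^ 2) ^ (9 / 10 : ℝ) * ‖𝓕 ⇑Ψ v‖ ^ 2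
  have hlim : Tendsto (fun X : ℝ ↦ K * X ^ 3) (𝓝[>] √S) (𝓝 (K * √S ^ 3)) :=
    (Continuous.tendsto (by fun_prop) _).mono_left nhdsWithin_le_nhds
  refine ge_of_tendsto hlim ?_
  filter_upwards [self_mem_nhdsWithin] with X hX
  have hX0 : 0 < X := (Real.sqrt_nonneg S).trans_lt hX
  exact h Ψ X hX0 ((Real.sqrt_lt' hX0).1 hX).le

/-- A Schwartz function on the product `ℝ³ × ℝ` viewed on the Euclidean space-time. -/
def toSpaceTime (ψ : SchwartzMap (Rn 3 × ℝ) ℂ) : SchwartzMap SpaceTime ℂ :=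
  SchwartzMap.compCLMOfContinuousLinearEquiv ℝ (WithLp.prodContinuousLinearEquiv 2 ℝ (Rn 3) ℝ) ψ

theorem toSpaceTime_toLp (ψ : SchwartzMap (Rn 3 × ℝ) ℂ) (p : Rn 3 × ℝ) :
    toSpaceTime ψ (WithLp.toLp 2 p) = ψ p := rfl

theorem stFourier_eq_fourier (ψ : SchwartzMap (Rn 3 × ℝ) ℂ) (ξ : Rn 3) (τ : ℝ) :
    stFourier 3 (fun x t ↦ ψ (x, t)) ξ τ = 𝓕 ⇑(toSpaceTime ψ) (WithLp.toLp 2 (ξ, τ)) := by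
  rw [Real.fourier_eq', integral_spaceTime, Measure.volume_eq_prod, integral_prod]
  · unfold stFourier
    simp only [WithLp.prod_inner_apply, toSpaceTime_toLp]
    simp [mul_comm]
  · have hψ : Integrable fun p : Rn 3 × ℝ ↦ toSpaceTime ψ (WithLp.toLp 2 p) :=
      integrable_spaceTime_iff.1 (toSpaceTime ψ).integrable
    have hexp : Continuous fun p : Rn 3 × ℝ ↦
        cexp (↑(-2 * Real.pi * ⟪WithLp.toLp 2 p, WithLp.toLp 2 (ξ, τ)⟫) * I) := by
      simp only [WithLp.prod_inner_apply]
      fun_prop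
    refine hψ.norm.mono' (hexp.aestronglyMeasurable.smul hψ.1) (.of_forall fun p ↦ ?_)
    rw [norm_smul, Complex.norm_exp_ofReal_mul_I, one_mul]

theorem XNorm_eq_sqrt (ψ : SchwartzMap (Rn 3 × ℝ) ℂ) {b : ℝ} (hb : 2 * b ≤ 1) :
    XNorm 3 0 b (fun x t ↦ ψ (x, t)) = √(∫ v : SpaceTime,
      japR (v.snd - ‖v.fst‖ ^ 2) ^ (2 * b) * ‖𝓕 ⇑(toSpaceTime ψ) v‖ ^ 2) := by
  have hint := integrable_japR_rpow_mul_norm_sq (𝓕 (toSpaceTime ψ)) hb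
  rw [integrable_spaceTime_iff] at hint
  rw [XNorm, ← Real.sqrt_eq_rpow, ← SchwartzMap.fourier_coe, integral_spaceTime,
    Measure.volume_eq_prod, integral_prod _ hint]
  simp only [stFourier_eq_fourier, SchwartzMap.fourier_coe, mul_zero, Real.rpow_zero, one_mul]
  rfl

theorem lpNormST_three_eq (ψ : SchwartzMap (Rn 3 × ℝ) ℂ) :
    lpNormST 3 3 (fun x t ↦ ψ (x, t)) = (∫ v, ‖toSpaceTime ψ v‖ ^ (3 : ℝ)) ^ (1 / 3 : ℝ) := by
  have hint : Integrable fun v ↦ ‖toSpaceTime ψ v‖ ^ (3 : ℝ) := by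
    have := ((toSpaceTime ψ).memLp 3).integrable_norm_rpow (by norm_num) (by norm_num)
    simpa using this
  rw [integrable_spaceTime_iff] at hint
  rw [lpNormST, integral_spaceTime, Measure.volume_eq_prod, integral_prod_symm _ hint]
  rfl

/-- L³ space-time estimate in ℝ^{3+1}. -/
theorem statement_17 :
    ∃ ε₀ > (0:ℝ), ∀ ε : ℝ, 0 < ε → ε < ε₀ →
    ∃ C > (0:ℝ), ∀ ψ : SchwartzMap (Rn 3 × ℝ) ℂ,
    lpNormST 3 3 (fun x t => ψ (x, t))
      ≤ C * XNorm 3 0 (1/2 - 2 * ε) (fun x t => ψ (x, t)) := by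
  obtain ⟨K, hK, h⟩ := exists_integral_norm_cube_le
  refine ⟨1 / 40, by norm_num, fun ε hε hε' ↦ ⟨K ^ (1 / 3 : ℝ), by positivity, fun ψ ↦ ?_⟩⟩
  have hb : 2 * (1 / 2 - 2 * ε) ≤ 1 := by linarith
  rw [XNorm_eq_sqrt ψ hb, lpNormST_three_eq]
  have hmono : (∫ v : SpaceTime, japR (v.snd - ‖v.fst‖ ^ 2) ^ (9 / 10 : ℝ) *
      ‖𝓕 ⇑(toSpaceTime ψ) v‖ ^ 2) ≤ ∫ v : SpaceTime,
      japR (v.snd - ‖v.fst‖ ^ 2) ^ (2 * (1 / 2 - 2 * ε)) * ‖𝓕 ⇑(toSpaceTime ψ) v‖ ^ 2 := by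
    rw [← SchwartzMap.fourier_coe]
    refine integral_mono (integrable_japR_rpow_mul_norm_sq _ (by norm_num))
      (integrable_japR_rpow_mul_norm_sq _ hb) fun v ↦ ?_
    exact mul_le_mul_of_nonneg_right
      (Real.rpow_le_rpow_of_exponent_le (one_le_japR _) (by linarith)) (sq_nonneg _)
  have h3 : ∀ x : ℝ, 0 ≤ x → (x ^ 3) ^ (1 / 3 : ℝ) = x := fun x hx ↦ by
    rw [← Real.rpow_natCast, ← Real.rpow_mul hx]
    norm_num
  calc _ ≤ (K * √(∫ v : SpaceTime, japR (v.snd - ‖v.fst‖ ^ 2) ^ (9 / 10 : ℝ) *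
        ‖𝓕 ⇑(toSpaceTime ψ) v‖ ^ 2) ^ 3) ^ (1 / 3 : ℝ) := by
        gcongr
        exact h _
    _ ≤ _ := by
        rw [Real.mul_rpow hK.le (by positivity), h3 _ (Real.sqrt_nonneg _)]
        gcongr

end
end

section
/- Comparison between the modified energy and Sobolev norms. Let n ∈ {2, 3} and s ∈ (0, 1). There is a constant C = C(s, n, m₁) such that for every N ≥ 1 and every Schwartz function f on ℝⁿ: (a) E(I_N f) ≤ C (N^{1−s} ‖f‖_{Ḣ^s})² + C ‖f‖⁴_{L⁴(ℝⁿ)}; and (b) ‖f‖²_{H^s} ≤ C (E(I_N f) + ‖f‖²_{L²(ℝⁿ)}). -/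
open MeasureTheory Complex Set
open scoped FourierTransform BigOperators RealInnerProductSpace

noncomputable section

open scoped ContDiff SchwartzMap ENNReal

section DyadicScaling

variable {V : Type*} [NormedAddCommGroup V] [NormedSpace ℝ V] [FiniteDimensional ℝ V]

/-- A smooth function that contracts under dyadic dilation away from the origin has bounded
derivatives of all orders, hence temperate growth. -/
theorem hasTemperateGrowth_of_eq_mul_comp_half {g : V → ℝ} (hg : ContDiff ℝ ∞ g) {c R : ℝ}
    (hc : |c| ≤ 1) (hR : 0 < R) (h : ∀ ξ, R ≤ ‖ξ‖ → g ξ = c * g ((1 / 2 : ℝ) • ξ)) :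
    g.HasTemperateGrowth := by
  have : ProperSpace V := FiniteDimensional.proper_real V
  refine ⟨hg, fun k => ?_⟩
  have hgk : ContDiff ℝ k g := hg.of_le (mod_cast le_top)
  have hstep : ∀ ξ : V, R < ‖ξ‖ →
      ‖iteratedFDeriv ℝ k g ξ‖ ≤ ‖iteratedFDeriv ℝ k g ((1 / 2 : ℝ) • ξ)‖ := by
    intro ξ hξ
    have hev : g =ᶠ[nhds ξ] c • fun η => g ((1 / 2 : ℝ) • η) := by
      filter_upwards [(isOpen_lt continuous_const continuous_norm).mem_nhds hξ] with η hη
      simpa using h η (le_of_lt hη)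
    have hcomp : ContDiff ℝ k fun η => g ((1 / 2 : ℝ) • η) :=
      hgk.comp (contDiff_const_smul (1 / 2 : ℝ))
    rw [(Filter.EventuallyEq.iteratedFDeriv ℝ hev k).eq_of_nhds,
      iteratedFDeriv_const_smul_apply hcomp.contDiffAt, iteratedFDeriv_comp_const_smul _ hgk,
      norm_smul, norm_smul, Real.norm_eq_abs, ← mul_assoc]
    refine mul_le_of_le_one_left (norm_nonneg _) (mul_le_one₀ hc (norm_nonneg _) ?_)
    rw [norm_pow]
    exact pow_le_one₀ (norm_nonneg _) (by norm_num)
  obtain ⟨M, hM⟩ := (isCompact_closedBall (0 : V) R).exists_bound_of_continuousOn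
    (hgk.continuous_iteratedFDeriv le_rfl).continuousOn
  have hball : ∀ j : ℕ, ∀ ξ : V, ‖ξ‖ ≤ 2 ^ j * R → ‖iteratedFDeriv ℝ k g ξ‖ ≤ M := by
    intro j
    induction j with
    | zero => exact fun ξ hξ => hM ξ (by simpa using hξ)
    | succ j ih =>
      intro ξ hξ
      rcases le_or_gt ‖ξ‖ R with h1 | h1
      · exact hM ξ (by simpa using h1)
      · refine (hstep ξ h1).trans (ih _ ?_)
        rw [norm_smul, Real.norm_of_nonneg (by norm_num)]
        rw [pow_succ] at hξ
        linarith
  refine ⟨0, M, fun ξ => ?_⟩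
  obtain ⟨j, hj⟩ := pow_unbounded_of_one_lt (‖ξ‖ / R) (one_lt_two)
  simpa using hball j ξ ((div_le_iff₀ hR).mp hj.le)

end DyadicScaling

section Young

/-- Jensen's inequality for a (not normalized) weight `k`. -/
theorem lintegral_mul_rpow_le {α : Type*} [MeasurableSpace α] {μ : Measure α} {k F : α → ℝ≥0∞}
    (hk : AEMeasurable k μ) (hF : AEMeasurable F μ) {p : ℝ} (hp : 1 ≤ p) :
    (∫⁻ y, k y * F y ∂μ) ^ p ≤ (∫⁻ y, k y ∂μ) ^ (p - 1) * ∫⁻ y, k y * F y ^ p ∂μ := by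
  have hp0 : 0 < p := by linarith
  have hinv : p⁻¹ ≤ 1 := inv_le_one_of_one_le₀ hp
  have key := ENNReal.lintegral_mul_norm_pow_le (p := 1 - p⁻¹) (q := p⁻¹) hk
    (hk.mul (hF.pow_const p)) (by linarith) (by positivity) (by ring)
  have heq : ∀ y, k y ^ (1 - p⁻¹) * (k y * F y ^ p) ^ p⁻¹ = k y * F y := by
    intro y
    rw [ENNReal.mul_rpow_of_nonneg _ _ (by positivity), ENNReal.rpow_rpow_inv hp0.ne', ← mul_assoc,
      ← ENNReal.rpow_add_of_nonneg _ _ (by linarith) (by positivity)]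
    simp
  simp only [Pi.mul_apply, heq] at key
  calc (∫⁻ y, k y * F y ∂μ) ^ p
      ≤ ((∫⁻ y, k y ∂μ) ^ (1 - p⁻¹) * (∫⁻ y, k y * F y ^ p ∂μ) ^ p⁻¹) ^ p := by gcongr
    _ = _ := by
      rw [ENNReal.mul_rpow_of_nonneg _ _ hp0.le, ← ENNReal.rpow_mul, ENNReal.rpow_inv_rpow hp0.ne']
      congr 2
      field_simp

variable {V : Type*} [NormedAddCommGroup V] [MeasurableSpace V] [BorelSpace V]
  [SecondCountableTopology V] {μ : Measure V} [SFinite μ] [μ.IsAddRightInvariant]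

theorem lintegral_lintegral_mul_sub_rpow_le {k F : V → ℝ≥0∞} (hk : Measurable k)
    (hF : Measurable F) {p : ℝ} (hp : 1 ≤ p) :
    ∫⁻ x, (∫⁻ y, k y * F (x - y) ∂μ) ^ p ∂μ ≤ (∫⁻ y, k y ∂μ) ^ p * ∫⁻ x, F x ^ p ∂μ := by
  have hmeas : Measurable fun z : V × V => k z.2 * F (z.1 - z.2) ^ p := by fun_prop
  calc ∫⁻ x, (∫⁻ y, k y * F (x - y) ∂μ) ^ p ∂μ
      ≤ ∫⁻ x, (∫⁻ y, k y ∂μ) ^ (p - 1) * ∫⁻ y, k y * F (x - y) ^ p ∂μ ∂μ :=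
        lintegral_mono fun x => lintegral_mul_rpow_le hk.aemeasurable
          (hF.comp (measurable_const.sub measurable_id)).aemeasurable hp
    _ = (∫⁻ y, k y ∂μ) ^ (p - 1) * ∫⁻ y, ∫⁻ x, k y * F (x - y) ^ p ∂μ ∂μ := by
        rw [lintegral_const_mul _ hmeas.lintegral_prod_right',
          lintegral_lintegral_swap hmeas.aemeasurable]
    _ = (∫⁻ y, k y ∂μ) ^ (p - 1) * ((∫⁻ y, k y ∂μ) * ∫⁻ x, F x ^ p ∂μ) := by
        congr 1
        rw [← lintegral_mul_const _ hk]
        refine lintegral_congr fun y => ?_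
        rw [lintegral_const_mul _ (by fun_prop), lintegral_sub_right_eq_self (fun x => F x ^ p) y]
    _ = _ := by
        rw [← mul_assoc]
        congr 1
        nth_rewrite 2 [← ENNReal.rpow_one (∫⁻ y, k y ∂μ)]
        rw [← ENNReal.rpow_add_of_nonneg _ _ (by linarith) zero_le_one]
        simp

/-- Young's inequality `L¹ * Lᵖ ⊆ Lᵖ` for finite `p`. -/
theorem eLpNorm_integral_mul_sub_le {K f : V → ℂ} (hK : Measurable K) (hf : Measurable f)
    {p : ℝ≥0∞} (hp : 1 ≤ p) (hp' : p ≠ ⊤) :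
    eLpNorm (fun x => ∫ y, K y * f (x - y) ∂μ) p μ ≤ (∫⁻ y, ‖K y‖ₑ ∂μ) * eLpNorm f p μ := by
  have hp0 : p ≠ 0 := (zero_lt_one.trans_le hp).ne'
  have hp1 : 1 ≤ p.toReal := by
    rw [← ENNReal.toReal_one]
    exact ENNReal.toReal_mono hp' hp
  have hpos : 0 < p.toReal := by linarith
  rw [eLpNorm_eq_lintegral_rpow_enorm_toReal hp0 hp', eLpNorm_eq_lintegral_rpow_enorm_toReal hp0 hp']
  calc (∫⁻ x, ‖∫ y, K y * f (x - y) ∂μ‖ₑ ^ p.toReal ∂μ) ^ (1 / p.toReal)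
      ≤ (∫⁻ x, (∫⁻ y, ‖K y‖ₑ * ‖f (x - y)‖ₑ ∂μ) ^ p.toReal ∂μ) ^ (1 / p.toReal) := by
        gcongr with x
        refine (enorm_integral_le_lintegral_enorm _).trans_eq ?_
        simp [enorm_mul]
    _ ≤ ((∫⁻ y, ‖K y‖ₑ ∂μ) ^ p.toReal * ∫⁻ x, ‖f x‖ₑ ^ p.toReal ∂μ) ^ (1 / p.toReal) := by
        gcongr
        exact lintegral_lintegral_mul_sub_rpow_le hK.enorm hf.enorm hp1
    _ = _ := by
        rw [ENNReal.mul_rpow_of_nonneg _ _ (by positivity), one_div, ENNReal.rpow_rpow_inv hpos.ne']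

end Young

namespace SchwartzMap

variable {V : Type*} [NormedAddCommGroup V] [InnerProductSpace ℝ V] [FiniteDimensional ℝ V]
  [MeasurableSpace V] [BorelSpace V]

theorem fourier_fourierMultiplierCLM_apply {g : V → ℝ} (hg : g.HasTemperateGrowth)
    (f : 𝓢(V, ℂ)) (ξ : V) :
    𝓕 (fourierMultiplierCLM ℂ g f) ξ = (g ξ : ℂ) * 𝓕 f ξ := by
  rw [fourierMultiplierCLM_apply, FourierTransform.fourier_fourierInv_eq,
    smulLeftCLM_apply_apply hg, Complex.real_smul]

theorem integral_norm_fourierInv_comp_inv_smul (h : V → ℂ) {R : ℝ} (hR : 0 < R) :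
    ∫ x, ‖𝓕⁻ (fun ξ => h (R⁻¹ • ξ)) x‖ = ∫ x, ‖𝓕⁻ h x‖ := by
  have hscale : ∀ x, 𝓕⁻ (fun ξ => h (R⁻¹ • ξ)) x
      = (R ^ Module.finrank ℝ V : ℝ) • 𝓕⁻ h (R • x) := by
    intro x
    rw [Real.fourierInv_eq', Real.fourierInv_eq',
      ← Measure.integral_comp_inv_smul_of_nonneg volume _ hR.le]
    simp [inner_smul_left, inner_smul_right, hR.ne']
  simp_rw [hscale, norm_smul]
  rw [integral_const_mul,
    Measure.integral_comp_smul_of_nonneg volume (fun x => ‖𝓕⁻ h x‖) R (hR := hR.le),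
    Real.norm_of_nonneg (by positivity), smul_eq_mul, ← mul_assoc, mul_inv_cancel₀ (by positivity),
    one_mul]

theorem norm_toLp_convolution_le (K f : 𝓢(V, ℂ)) {p : ℝ≥0∞} (hp : 1 ≤ p) (hp' : p ≠ ⊤) :
    ‖(convolution (ContinuousLinearMap.mul ℂ ℂ) K f).toLp p‖ ≤ (∫ x, ‖K x‖) * ‖f.toLp p‖ := by
  have hconv : ⇑(convolution (ContinuousLinearMap.mul ℂ ℂ) K f)
      = fun x => ∫ y, K y * f (x - y) := by
    ext x
    simp [convolution_apply, MeasureTheory.convolution_def]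
  rw [norm_toLp, norm_toLp, hconv,
    integral_norm_eq_lintegral_enorm K.continuous.aestronglyMeasurable, ← ENNReal.toReal_mul]
  have hK : ∫⁻ y, ‖K y‖ₑ ≠ ⊤ := (K.integrable (μ := volume)).2.ne
  have hf : eLpNorm f p volume ≠ ⊤ := (f.memLp p volume).eLpNorm_ne_top
  refine ENNReal.toReal_mono (ENNReal.mul_ne_top hK hf) ?_
  exact eLpNorm_integral_mul_sub_le K.continuous.measurable f.continuous.measurable hp hp'

/-- Dilates of a smooth compactly supported Fourier multiplier are uniformly bounded on `Lᵖ`. -/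
theorem exists_norm_toLp_fourierMultiplierCLM_comp_smul_le {d : V → ℝ} (hd : ContDiff ℝ ∞ d)
    (hd' : HasCompactSupport d) {p : ℝ≥0∞} (hp : 1 ≤ p) (hp' : p ≠ ⊤) :
    ∃ D : ℝ, 0 ≤ D ∧ ∀ R : ℝ, 0 < R → ∀ f : 𝓢(V, ℂ),
      ‖(fourierMultiplierCLM ℂ (fun ξ => d (R⁻¹ • ξ)) f).toLp p‖ ≤ D * ‖f.toLp p‖ := by
  refine ⟨∫ x, ‖𝓕⁻ (fun ξ => (d ξ : ℂ)) x‖, integral_nonneg fun _ => norm_nonneg _, ?_⟩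
  intro R hR f
  have hdR : ContDiff ℝ ∞ fun ξ => d (R⁻¹ • ξ) := hd.comp (contDiff_const_smul R⁻¹)
  have hdR' : HasCompactSupport fun ξ => d (R⁻¹ • ξ) := hd'.comp_smul (inv_ne_zero hR.ne')
  have hC : ContDiff ℝ ∞ fun ξ => (d (R⁻¹ • ξ) : ℂ) :=
    Complex.ofRealCLM.contDiff.comp (n := ∞) (f := fun ξ => d (R⁻¹ • ξ)) hdR
  have hC' : HasCompactSupport fun ξ => (d (R⁻¹ • ξ) : ℂ) :=
    hdR'.comp_left (g := Complex.ofReal) Complex.ofReal_zero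
  let m : 𝓢(V, ℂ) := hC'.toSchwartzMap hC
  have hT : fourierMultiplierCLM ℂ (fun ξ => d (R⁻¹ • ξ)) f
      = convolution (ContinuousLinearMap.mul ℂ ℂ) (𝓕⁻ m) f := by
    have : 𝓕 (fourierMultiplierCLM ℂ (fun ξ => d (R⁻¹ • ξ)) f)
        = 𝓕 (convolution (ContinuousLinearMap.mul ℂ ℂ) (𝓕⁻ m) f) := by
      ext ξ
      rw [fourier_fourierMultiplierCLM_apply (hdR'.hasTemperateGrowth hdR), fourier_convolution,
        FourierTransform.fourier_fourierInv_eq]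
      simp [m]
    simpa using congrArg (𝓕⁻ ·) this
  have hm : ∫ x, ‖(𝓕⁻ m) x‖ = ∫ x, ‖𝓕⁻ (fun ξ => (d ξ : ℂ)) x‖ := by
    rw [fourierInv_coe]
    exact integral_norm_fourierInv_comp_inv_smul (fun ξ => (d ξ : ℂ)) hR
  rw [hT, ← hm]
  exact norm_toLp_convolution_le _ _ hp hp'

theorem norm_toLp_pow {p : ℕ} (hp : p ≠ 0) (f : 𝓢(V, ℂ)) :
    ‖f.toLp (p : ℝ≥0∞)‖ ^ p = ∫ x, ‖f x‖ ^ p := by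
  rw [norm_toLp' (by simpa using hp) (by simp)]
  simp only [ENNReal.toReal_natCast, Real.rpow_natCast]
  exact Real.rpow_inv_natCast_pow (by positivity) hp

theorem integrable_norm_pow {p : ℕ} (hp : p ≠ 0) (f : 𝓢(V, ℂ)) :
    Integrable fun x => ‖f x‖ ^ p :=
  (f.memLp (p : ℝ≥0∞)).integrable_norm_pow hp

theorem norm_apply_le_integral_norm_fourier (f : 𝓢(V, ℂ)) (x : V) : ‖f x‖ ≤ ∫ ξ, ‖𝓕 f ξ‖ := by
  have hinv : f x = 𝓕⁻ (⇑(𝓕 f : 𝓢(V, ℂ))) x := by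
    rw [← fourierInv_coe, FourierTransform.fourierInv_fourier_eq (F := 𝓢(V, ℂ))]
  rw [hinv, Real.fourierInv_eq']
  refine (norm_integral_le_integral_norm _).trans_eq ?_
  refine integral_congr_ae (.of_forall fun ξ => ?_)
  simp only
  rw [norm_smul, Complex.norm_exp]
  simp

/-- A Fourier multiplier bounded by one maps a Schwartz function into a fixed ball of `L⁴`. -/
theorem integral_norm_fourierMultiplierCLM_pow_four_le {g : V → ℝ} (hg : g.HasTemperateGrowth)
    (hg1 : ∀ ξ, |g ξ| ≤ 1) (f : 𝓢(V, ℂ)) :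
    ∫ x, ‖fourierMultiplierCLM ℂ g f x‖ ^ 4 ≤ (∫ ξ, ‖𝓕 f ξ‖) ^ 2 * ∫ x, ‖f x‖ ^ 2 := by
  set h := fourierMultiplierCLM ℂ g f with hh
  have hle : ∀ ξ, ‖𝓕 h ξ‖ ≤ ‖𝓕 f ξ‖ := by
    intro ξ
    rw [hh, fourier_fourierMultiplierCLM_apply hg, norm_mul, Complex.norm_real]
    exact mul_le_of_le_one_left (norm_nonneg _) (hg1 ξ)
  have hsup : ∀ x, ‖h x‖ ≤ ∫ ξ, ‖𝓕 f ξ‖ := fun x =>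
    (norm_apply_le_integral_norm_fourier h x).trans
      (integral_mono (𝓕 h).integrable.norm (𝓕 f).integrable.norm hle)
  calc ∫ x, ‖h x‖ ^ 4 ≤ ∫ x, (∫ ξ, ‖𝓕 f ξ‖) ^ 2 * ‖h x‖ ^ 2 := by
        refine integral_mono (integrable_norm_pow (by norm_num) h)
          ((integrable_norm_pow (by norm_num) h).const_mul _) fun x => ?_
        have : ‖h x‖ ^ 4 = ‖h x‖ ^ 2 * ‖h x‖ ^ 2 := by ring
        simp only [this]
        gcongr
        exact hsup x
    _ = (∫ ξ, ‖𝓕 f ξ‖) ^ 2 * ∫ ξ, ‖𝓕 h ξ‖ ^ 2 := by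
        rw [integral_const_mul, integral_norm_sq_fourier]
    _ ≤ (∫ ξ, ‖𝓕 f ξ‖) ^ 2 * ∫ ξ, ‖𝓕 f ξ‖ ^ 2 := by
        gcongr ?_ * ?_
        refine integral_mono (integrable_norm_pow (by norm_num) (𝓕 h))
          (integrable_norm_pow (by norm_num) (𝓕 f)) fun ξ => ?_
        have := hle ξ
        simp only
        gcongr
    _ = _ := by rw [integral_norm_sq_fourier]

/-- A smooth multiplier that is bounded by one and contracts under dyadic dilation away from the
origin acts boundedly on `L⁴`, uniformly over its dilates. -/
theorem exists_norm_toLp_four_fourierMultiplierCLM_le {m : V → ℝ} (hm : ContDiff ℝ ∞ m)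
    (hm1 : ∀ ξ, |m ξ| ≤ 1) {c R : ℝ} (hc0 : 0 ≤ c) (hc1 : c < 1) (hR : 0 < R)
    (h : ∀ ξ, R ≤ ‖ξ‖ → m ξ = c * m ((1 / 2 : ℝ) • ξ)) :
    ∃ D : ℝ, 0 ≤ D ∧ ∀ N : ℝ, 0 < N → ∀ f : 𝓢(V, ℂ),
      ‖(fourierMultiplierCLM ℂ (fun ξ => m (N⁻¹ • ξ)) f).toLp 4‖ ≤ D * ‖f.toLp 4‖ := by
  have : Fact ((1 : ℝ≥0∞) ≤ 4) := ⟨by norm_num⟩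
  have hmg : m.HasTemperateGrowth :=
    hasTemperateGrowth_of_eq_mul_comp_half hm (by rw [abs_of_nonneg hc0]; exact hc1.le) hR h
  have hmN : ∀ N : ℝ, (fun ξ => m (N⁻¹ • ξ)).HasTemperateGrowth := fun N =>
    hmg.comp (N⁻¹ • ContinuousLinearMap.id ℝ V).hasTemperateGrowth
  let d : V → ℝ := fun ξ => m ξ - c * m ((1 / 2 : ℝ) • ξ)
  have hd : ContDiff ℝ ∞ d :=
    hm.sub (contDiff_const.mul (hm.comp (contDiff_const_smul (1 / 2 : ℝ))))
  have hd' : HasCompactSupport d := by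
    refine HasCompactSupport.intro (isCompact_closedBall (0 : V) R) fun ξ hξ => ?_
    exact sub_eq_zero.mpr (h ξ (by simpa using (not_le.mp (by simpa using hξ)).le))
  have hdN : ∀ N : ℝ, (fun ξ => d (N⁻¹ • ξ)).HasTemperateGrowth := fun N =>
    (hd'.hasTemperateGrowth hd).comp (N⁻¹ • ContinuousLinearMap.id ℝ V).hasTemperateGrowth
  obtain ⟨D, hD, hDbound⟩ := exists_norm_toLp_fourierMultiplierCLM_comp_smul_le hd hd'
    (p := 4) (by norm_num) (by simp)
  refine ⟨D / (1 - c), div_nonneg hD (by linarith), fun N hN f => ?_⟩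
  set a : ℝ → ℝ := fun M => ‖(fourierMultiplierCLM ℂ (fun ξ => m (M⁻¹ • ξ)) f).toLp 4‖ with ha
  have hstep : ∀ M, 0 < M → a M ≤ D * ‖f.toLp 4‖ + c * a (2 * M) := by
    intro M hM
    have hsplit : fourierMultiplierCLM ℂ (fun ξ => m (M⁻¹ • ξ)) f
        = fourierMultiplierCLM ℂ (fun ξ => d (M⁻¹ • ξ)) f
          + (c : ℝ) • fourierMultiplierCLM ℂ (fun ξ => m ((2 * M)⁻¹ • ξ)) f := by
      have hfun : (fun ξ => m (M⁻¹ • ξ))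
          = (fun ξ => d (M⁻¹ • ξ)) + c • fun ξ => m ((2 * M)⁻¹ • ξ) := by
        ext ξ
        simp [d, smul_smul, mul_comm M⁻¹]
      have hcm : (c • fun ξ => m ((2 * M)⁻¹ • ξ)).HasTemperateGrowth :=
        (Function.HasTemperateGrowth.const c).mul (hmN (2 * M))
      rw [hfun, ← _root_.smul_apply, ← fourierMultiplierCLM_smul (hmN (2 * M))]
      simp only [fourierMultiplierCLM_apply]
      rw [smulLeftCLM_add (hdN M) hcm, _root_.add_apply, FourierTransform.fourierInv_add]
    have hLp : (fourierMultiplierCLM ℂ (fun ξ => m (M⁻¹ • ξ)) f).toLp 4 volume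
        = (fourierMultiplierCLM ℂ (fun ξ => d (M⁻¹ • ξ)) f).toLp 4 volume
          + (c : ℝ) • (fourierMultiplierCLM ℂ (fun ξ => m ((2 * M)⁻¹ • ξ)) f).toLp 4 volume := by
      rw [hsplit]
      rfl
    have hnn : ‖(c : ℝ) • (fourierMultiplierCLM ℂ (fun ξ => m ((2 * M)⁻¹ • ξ)) f).toLp 4 volume‖
        = c * a (2 * M) := by
      rw [norm_smul, Real.norm_of_nonneg hc0]
    calc a M ≤ ‖(fourierMultiplierCLM ℂ (fun ξ => d (M⁻¹ • ξ)) f).toLp 4‖ + c * a (2 * M) := by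
          simp only [ha, hLp]
          exact (norm_add_le _ _).trans_eq (by rw [hnn])
      _ ≤ _ := by gcongr; exact hDbound M hM f
  obtain ⟨B, hB⟩ : ∃ B, ∀ M, a M ≤ B := by
    refine ⟨1 + (∫ ξ, ‖𝓕 f ξ‖) ^ 2 * ∫ x, ‖f x‖ ^ 2, fun M => ?_⟩
    have h4 := integral_norm_fourierMultiplierCLM_pow_four_le (hmN M) (fun ξ => hm1 _) f
    rw [← norm_toLp_pow (by norm_num)] at h4
    have h5 : a M ^ 4 ≤ (∫ ξ, ‖𝓕 f ξ‖) ^ 2 * ∫ x, ‖f x‖ ^ 2 := by simpa [ha] using h4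
    nlinarith [sq_nonneg (a M ^ 2 - 1), sq_nonneg (a M - 1)]
  have hiter : ∀ j : ℕ, ∀ M, 0 < M → a M ≤ D * ‖f.toLp 4‖ / (1 - c) + c ^ j * |B| := by
    intro j
    have h1c : 0 < 1 - c := by linarith
    induction j with
    | zero =>
      intro M _
      have : 0 ≤ D * ‖f.toLp 4‖ / (1 - c) :=
        div_nonneg (mul_nonneg hD (norm_nonneg _)) h1c.le
      linarith [hB M, le_abs_self B, pow_zero c]
    | succ j ih =>
      intro M hM
      have h2 := mul_le_mul_of_nonneg_left (ih (2 * M) (by positivity)) hc0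
      have h3 : D * ‖f.toLp 4‖ + c * (D * ‖f.toLp 4‖ / (1 - c)) = D * ‖f.toLp 4‖ / (1 - c) := by
        field_simp
        ring
      rw [pow_succ]
      linarith [hstep M hM]
  have hlim : Filter.Tendsto (fun j : ℕ => D * ‖f.toLp 4‖ / (1 - c) + c ^ j * |B|) Filter.atTop
      (nhds (D * ‖f.toLp 4‖ / (1 - c) + 0 * |B|)) :=
    ((tendsto_pow_atTop_nhds_zero_of_lt_one hc0 hc1).mul_const _).const_add _
  have := ge_of_tendsto' hlim fun j => hiter j N hN
  rwa [zero_mul, add_zero, mul_div_right_comm] at this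

theorem integrable_pow_mul_norm_sq (k : ℕ) (f : 𝓢(V, ℂ)) :
    Integrable fun ξ => ‖ξ‖ ^ k * ‖f ξ‖ ^ 2 := by
  refine ((f.integrable_pow_mul volume k).mul_const (SchwartzMap.seminorm ℝ 0 0 f)).mono'
    (by fun_prop) (.of_forall fun ξ => ?_)
  rw [Real.norm_of_nonneg (by positivity), sq, ← mul_assoc]
  gcongr
  exact norm_le_seminorm ℝ f ξ

/-- Plancherel's theorem for the gradient. -/
theorem sum_integral_norm_fderiv_sq {ι : Type*} [Fintype ι] (b : OrthonormalBasis ι ℝ V)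
    (f : 𝓢(V, ℂ)) :
    ∑ i, ∫ x, ‖fderiv ℝ f x (b i)‖ ^ 2 = (2 * Real.pi) ^ 2 * ∫ ξ, ‖ξ‖ ^ 2 * ‖𝓕 f ξ‖ ^ 2 := by
  have hi : ∀ i, ∫ x, ‖fderiv ℝ f x (b i)‖ ^ 2
      = ∫ ξ, (2 * Real.pi) ^ 2 * (‖⟪ξ, b i⟫‖ ^ 2 * ‖𝓕 f ξ‖ ^ 2) := by
    intro i
    simp_rw [← lineDerivOp_apply_eq_fderiv]
    rw [← integral_norm_sq_fourier]
    refine integral_congr_ae (.of_forall fun ξ => ?_)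
    have hg : (fun ξ : V => ⟪ξ, b i⟫).HasTemperateGrowth := by fun_prop
    simp only [fourier_lineDerivOp_eq, _root_.smul_apply, smulLeftCLM_apply_apply hg]
    simp [mul_pow, abs_of_pos Real.pi_pos]
  have hint : ∀ i, Integrable fun ξ => (2 * Real.pi) ^ 2 * (‖⟪ξ, b i⟫‖ ^ 2 * ‖𝓕 f ξ‖ ^ 2) := by
    intro i
    refine ((integrable_pow_mul_norm_sq 2 (𝓕 f)).mono' (by fun_prop)
      (.of_forall fun ξ => ?_)).const_mul _
    rw [Real.norm_of_nonneg (by positivity)]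
    gcongr
    simpa using norm_inner_le_norm (𝕜 := ℝ) ξ (b i)
  simp_rw [hi]
  rw [← integral_finsetSum _ fun i _ => hint i, ← integral_const_mul]
  refine integral_congr_ae (.of_forall fun ξ => ?_)
  simp only
  rw [← Finset.mul_sum, ← Finset.sum_mul, b.sum_sq_norm_inner_left]

end SchwartzMap

section Energy

variable {n : ℕ}

theorem energy_coe_schwartzMap (f : 𝓢(Rn n, ℂ)) :
    energy ⇑f = 2 * Real.pi ^ 2 * (∫ ξ, ‖ξ‖ ^ 2 * ‖𝓕 f ξ‖ ^ 2) + 1 / 4 * ∫ x, ‖f x‖ ^ 4 := by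
  have hD : ∀ i : Fin n,
      Integrable fun x => ‖fderiv ℝ f x (EuclideanSpace.single i (1 : ℝ))‖ ^ 2 := fun i =>
    SchwartzMap.integrable_norm_pow two_ne_zero
      (LineDeriv.lineDerivOp (EuclideanSpace.single i (1 : ℝ)) f : 𝓢(Rn n, ℂ))
  have h := SchwartzMap.sum_integral_norm_fderiv_sq (EuclideanSpace.basisFun (Fin n) ℝ) f
  simp only [EuclideanSpace.basisFun_apply] at h
  rw [energy, integral_add ((integrable_finsetSum _ fun i _ => hD i).const_mul _)
    ((SchwartzMap.integrable_norm_pow (by norm_num) f).const_mul _), integral_const_mul,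
    integral_const_mul, integral_finsetSum _ fun i _ => hD i, h]
  ring

end Energy

theorem jap_rpow_two_mul {n : ℕ} (s : ℝ) (ξ : Rn n) : jap ξ ^ (2 * s) = (1 + ‖ξ‖ ^ 2) ^ s := by
  rw [jap, Real.rpow_mul (Real.sqrt_nonneg _), Real.rpow_two, Real.sq_sqrt (by positivity)]

namespace IsAdmissibleMultiplier

variable {n : ℕ} {s : ℝ} {m₁ : Rn n → ℝ}

theorem abs_le_one (h : IsAdmissibleMultiplier n s m₁) (ξ : Rn n) : |m₁ ξ| ≤ 1 := by
  obtain ⟨-, h01, -⟩ := h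
  rw [abs_of_pos (h01 ξ).1]
  exact (h01 ξ).2

theorem eq_mul_comp_half (h : IsAdmissibleMultiplier n s m₁) (ξ : Rn n) (hξ : 4 ≤ ‖ξ‖) :
    m₁ ξ = (2 : ℝ) ^ (-(1 - s)) * m₁ ((1 / 2 : ℝ) • ξ) := by
  obtain ⟨-, -, -, -, -, htail⟩ := h
  have hn : ‖(1 / 2 : ℝ) • ξ‖ = ‖ξ‖ / 2 := by
    rw [norm_smul, Real.norm_of_nonneg (by norm_num)]
    ring
  rw [htail ξ (by linarith), htail _ (by rw [hn]; linarith), hn,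
    ← Real.mul_rpow (by norm_num) (by positivity), mul_div_cancel₀ _ two_ne_zero]

theorem hasTemperateGrowth_mN (h : IsAdmissibleMultiplier n s m₁) (hs : s < 1) (N : ℝ) :
    (mN m₁ N).HasTemperateGrowth := by
  have hc : |(2 : ℝ) ^ (-(1 - s))| ≤ 1 := by
    rw [abs_of_nonneg (by positivity)]
    exact Real.rpow_le_one_of_one_le_of_nonpos one_le_two (by linarith)
  exact (hasTemperateGrowth_of_eq_mul_comp_half h.1 hc four_pos h.eq_mul_comp_half).comp
    (N⁻¹ • ContinuousLinearMap.id ℝ (Rn n)).hasTemperateGrowth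

theorem Iop_eq (h : IsAdmissibleMultiplier n s m₁) (hs : s < 1) (N : ℝ) (f : 𝓢(Rn n, ℂ)) :
    Iop m₁ N ⇑f = ⇑(SchwartzMap.fourierMultiplierCLM ℂ (mN m₁ N) f) := by
  ext x
  rw [SchwartzMap.fourierMultiplierCLM_apply, SchwartzMap.fourierInv_coe, Iop]
  refine congrFun (congrArg _ (funext fun ξ => ?_)) x
  rw [SchwartzMap.smulLeftCLM_apply_apply (h.hasTemperateGrowth_mN hs N), Complex.real_smul,
    SchwartzMap.fourier_coe]

theorem norm_sq_mul_mN_sq_le (h : IsAdmissibleMultiplier n s m₁) (hs0 : 0 < s) (hs : s < 1)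
    {N : ℝ} (hN : 1 ≤ N) (ξ : Rn n) :
    ‖ξ‖ ^ 2 * mN m₁ N ξ ^ 2 ≤ 4 * (N ^ (1 - s)) ^ 2 * ‖ξ‖ ^ (2 * s) := by
  obtain ⟨-, h01, -, -, -, htail⟩ := h
  have hN0 : 0 < N := by linarith
  have hn : ‖N⁻¹ • ξ‖ = ‖ξ‖ / N := by
    rw [norm_smul, norm_inv, Real.norm_of_nonneg hN0.le]
    ring
  rcases (norm_nonneg ξ).eq_or_lt with h0 | h0
  · rw [← h0, Real.zero_rpow (by linarith)]
    simp
  have hm := h01 (N⁻¹ • ξ)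
  have hξ : ‖ξ‖ = ‖ξ‖ ^ s * ‖ξ‖ ^ (1 - s) := by
    rw [← Real.rpow_add h0, add_sub_cancel, Real.rpow_one]
  have hmain : ‖ξ‖ ^ (1 - s) * mN m₁ N ξ ≤ 2 * N ^ (1 - s) := by
    rcases le_total ‖ξ‖ (2 * N) with h2 | h2
    · calc ‖ξ‖ ^ (1 - s) * mN m₁ N ξ ≤ (2 * N) ^ (1 - s) * 1 := by
            gcongr
            · exact hm.1.le
            · exact hm.2
        _ = 2 ^ (1 - s) * N ^ (1 - s) := by rw [mul_one, Real.mul_rpow (by norm_num) hN0.le]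
        _ ≤ 2 ^ (1 : ℝ) * N ^ (1 - s) := by
            gcongr
            · norm_num
            · linarith
        _ = _ := by rw [Real.rpow_one]
    · have : mN m₁ N ξ = (‖ξ‖ / N) ^ (-(1 - s)) := by
        rw [mN, htail _ (by rw [hn, le_div_iff₀ hN0]; exact h2), hn]
      rw [this, Real.rpow_neg (by positivity), Real.div_rpow h0.le hN0.le, inv_div,
        mul_div_cancel₀ _ (by positivity)]
      linarith [Real.rpow_pos_of_pos hN0 (1 - s)]
  have hnn : 0 ≤ ‖ξ‖ ^ (1 - s) * mN m₁ N ξ := mul_nonneg (by positivity) hm.1.le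
  calc ‖ξ‖ ^ 2 * mN m₁ N ξ ^ 2 = (‖ξ‖ ^ s) ^ 2 * (‖ξ‖ ^ (1 - s) * mN m₁ N ξ) ^ 2 := by
        conv_lhs => rw [hξ]
        ring
    _ ≤ (‖ξ‖ ^ s) ^ 2 * (2 * N ^ (1 - s)) ^ 2 := by gcongr
    _ = _ := by
        rw [mul_comm 2 s, Real.rpow_mul h0.le, Real.rpow_two]
        ring

theorem jap_rpow_le (h : IsAdmissibleMultiplier n s m₁) (hs0 : 0 < s) (hs : s < 1)
    {N : ℝ} (hN : 1 ≤ N) (ξ : Rn n) :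
    jap ξ ^ (2 * s) ≤ 5 * (1 + ‖ξ‖ ^ 2 * mN m₁ N ξ ^ 2) := by
  obtain ⟨-, h01, -, hmono, -, htail⟩ := h
  have hprod : 0 ≤ ‖ξ‖ ^ 2 * mN m₁ N ξ ^ 2 := by positivity
  rw [jap_rpow_two_mul]
  rcases le_total ‖ξ‖ 2 with h2 | h2
  · have : (1 + ‖ξ‖ ^ 2) ^ s ≤ 1 + ‖ξ‖ ^ 2 :=
      Real.rpow_le_self_of_one_le (by nlinarith [sq_nonneg ‖ξ‖]) hs.le
    nlinarith [norm_nonneg ξ]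
  · have h0 : 0 < ‖ξ‖ := by linarith
    have hm : ‖ξ‖ ^ (-(1 - s)) ≤ mN m₁ N ξ := by
      rw [← htail ξ h2]
      refine hmono _ _ ?_
      rw [norm_smul, norm_inv, Real.norm_of_nonneg (by linarith)]
      exact mul_le_of_le_one_left h0.le (inv_le_one_of_one_le₀ hN)
    calc (1 + ‖ξ‖ ^ 2) ^ s ≤ (2 * ‖ξ‖ ^ 2) ^ s := by
          gcongr
          nlinarith
      _ = 2 ^ s * (‖ξ‖ ^ 2) ^ s := Real.mul_rpow (by norm_num) (by positivity)
      _ ≤ 2 * (‖ξ‖ ^ 2) ^ s := by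
          gcongr
          exact Real.rpow_le_self_of_one_le one_le_two hs.le
      _ = 2 * (‖ξ‖ * ‖ξ‖ ^ (-(1 - s))) ^ 2 := by
          have : ‖ξ‖ * ‖ξ‖ ^ (-(1 - s)) = ‖ξ‖ ^ s := by
            rw [← Real.rpow_one_add' h0.le (by linarith)]
            congr 1
            ring
          rw [this, ← Real.rpow_pow_comm h0.le]
      _ ≤ 2 * (‖ξ‖ * mN m₁ N ξ) ^ 2 := by gcongr
      _ ≤ _ := by
          rw [mul_pow]
          linarith

end IsAdmissibleMultiplier

section Norms

variable {n : ℕ}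

theorem sobNorm_sq (s : ℝ) (f : Rn n → ℂ) :
    sobNorm n s f ^ 2 = ∫ ξ, jap ξ ^ (2 * s) * ‖𝓕 f ξ‖ ^ 2 := by
  rw [sobNorm, ← Real.sqrt_eq_rpow, Real.sq_sqrt]
  exact integral_nonneg fun ξ =>
    mul_nonneg (Real.rpow_nonneg (Real.sqrt_nonneg _) _) (by positivity)

theorem sobNormHom_sq (s : ℝ) (f : Rn n → ℂ) :
    sobNormHom n s f ^ 2 = ∫ ξ, ‖ξ‖ ^ (2 * s) * ‖𝓕 f ξ‖ ^ 2 := by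
  rw [sobNormHom, ← Real.sqrt_eq_rpow, Real.sq_sqrt]
  exact integral_nonneg fun ξ => by positivity

theorem lpNorm_natCast_pow {p : ℕ} (hp : p ≠ 0) (f : Rn n → ℂ) :
    lpNorm n p f ^ p = ∫ x, ‖f x‖ ^ p := by
  simp only [_root_.lpNorm, Real.rpow_natCast, one_div]
  exact Real.rpow_inv_natCast_pow (by positivity) hp

theorem SchwartzMap.integrable_mul_norm_sq_of_le {w : Rn n → ℝ} (hw : Measurable w)
    (hw0 : ∀ ξ, 0 ≤ w ξ) (hle : ∀ ξ, w ξ ≤ 1 + ‖ξ‖ ^ 2) (f : 𝓢(Rn n, ℂ)) :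
    Integrable fun ξ => w ξ * ‖f ξ‖ ^ 2 := by
  refine ((integrable_pow_mul_norm_sq 0 f).add (integrable_pow_mul_norm_sq 2 f)).mono'
    (hw.mul (f.continuous.norm.pow 2).measurable).aestronglyMeasurable (.of_forall fun ξ => ?_)
  rw [Real.norm_of_nonneg (mul_nonneg (hw0 ξ) (by positivity)), Pi.add_apply, pow_zero, ← add_mul]
  gcongr
  exact hle ξ

end Norms

/-- Comparison between the modified energy and Sobolev norms. -/
theorem statement_18 :
    ∀ n : ℕ, (n = 2 ∨ n = 3) →
    ∀ s : ℝ, 0 < s → s < 1 →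
    ∀ m₁ : Rn n → ℝ, IsAdmissibleMultiplier n s m₁ →
    ∃ C > (0:ℝ),
    ∀ N : ℝ, 1 ≤ N → ∀ f : SchwartzMap (Rn n) ℂ,
      energy (Iop m₁ N ⇑f)
          ≤ C * (N ^ (1 - s) * sobNormHom n s ⇑f) ^ 2 + C * lpNorm n 4 ⇑f ^ 4 ∧
      sobNorm n s ⇑f ^ 2 ≤ C * (energy (Iop m₁ N ⇑f) + lpNorm n 2 ⇑f ^ 2) := by
  intro n _ s hs0 hs m₁ hm
  obtain ⟨D, hD, hDbound⟩ := SchwartzMap.exists_norm_toLp_four_fourierMultiplierCLM_le hm.1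
    hm.abs_le_one (by positivity)
    (Real.rpow_lt_one_of_one_lt_of_neg one_lt_two (show -(1 - s) < 0 by linarith)) four_pos
    hm.eq_mul_comp_half
  refine ⟨8 * Real.pi ^ 2 + D ^ 4 + 5, by positivity, fun N hN f => ?_⟩
  have hN0 : 0 < N := by linarith
  set g := SchwartzMap.fourierMultiplierCLM ℂ (mN m₁ N) f with hg
  have hgf : ∀ ξ, ‖𝓕 g ξ‖ ^ 2 = mN m₁ N ξ ^ 2 * ‖𝓕 f ξ‖ ^ 2 := by
    intro ξ
    rw [hg, SchwartzMap.fourier_fourierMultiplierCLM_apply (hm.hasTemperateGrowth_mN hs N),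
      norm_mul, Complex.norm_real, mul_pow, Real.norm_eq_abs, sq_abs]
  have hg4 : ∫ x, ‖g x‖ ^ 4 ≤ D ^ 4 * ∫ x, ‖f x‖ ^ 4 := by
    rw [← SchwartzMap.norm_toLp_pow four_ne_zero, ← SchwartzMap.norm_toLp_pow four_ne_zero,
      ← mul_pow]
    have : Fact ((1 : ℝ≥0∞) ≤ (4 : ℕ)) := ⟨by norm_num⟩
    exact pow_le_pow_left₀ (norm_nonneg (g.toLp (4 : ℕ) volume)) (hDbound N hN0 f) 4
  have hg4' : 0 ≤ ∫ x, ‖g x‖ ^ 4 := integral_nonneg fun x => by positivity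
  have hL4 : lpNorm n 4 ⇑f ^ 4 = ∫ x, ‖f x‖ ^ 4 := mod_cast lpNorm_natCast_pow four_ne_zero ⇑f
  have hL2 : lpNorm n 2 ⇑f ^ 2 = ∫ ξ, ‖𝓕 f ξ‖ ^ 2 := by
    rw [SchwartzMap.integral_norm_sq_fourier]
    exact mod_cast lpNorm_natCast_pow two_ne_zero ⇑f
  have hf4 : 0 ≤ ∫ x, ‖f x‖ ^ 4 := integral_nonneg fun x => by positivity
  have hf2 : 0 ≤ ∫ ξ, ‖𝓕 f ξ‖ ^ 2 := integral_nonneg fun x => by positivity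
  have hhom : 0 ≤ ∫ ξ, ‖ξ‖ ^ (2 * s) * ‖𝓕 f ξ‖ ^ 2 := integral_nonneg fun x => by positivity
  have hgrad : 0 ≤ ∫ ξ, ‖ξ‖ ^ 2 * ‖𝓕 g ξ‖ ^ 2 := integral_nonneg fun x => by positivity
  have hint := SchwartzMap.integrable_pow_mul_norm_sq 2 (𝓕 g)
  have hpi : 1 ≤ 2 * Real.pi ^ 2 := by nlinarith [Real.pi_gt_three]
  have hbase : ∀ ξ : Rn n, (1 + ‖ξ‖ ^ 2) ^ s ≤ 1 + ‖ξ‖ ^ 2 := fun ξ =>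
    Real.rpow_le_self_of_one_le (by nlinarith [sq_nonneg ‖ξ‖]) hs.le
  rw [hm.Iop_eq hs, ← hg, energy_coe_schwartzMap, mul_pow, sobNormHom_sq, sobNorm_sq, hL4, hL2,
    ← SchwartzMap.fourier_coe]
  constructor
  · have hw : Integrable fun ξ : Rn n => ‖ξ‖ ^ (2 * s) * ‖𝓕 f ξ‖ ^ 2 := by
      refine SchwartzMap.integrable_mul_norm_sq_of_le (by fun_prop) (fun ξ => by positivity)
        (fun ξ => le_trans ?_ (hbase ξ)) (𝓕 f)
      rw [Real.rpow_mul (norm_nonneg ξ), Real.rpow_two]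
      gcongr
      linarith
    have hkey : ∫ ξ, ‖ξ‖ ^ 2 * ‖𝓕 g ξ‖ ^ 2
        ≤ 4 * (N ^ (1 - s)) ^ 2 * ∫ ξ, ‖ξ‖ ^ (2 * s) * ‖𝓕 f ξ‖ ^ 2 := by
      rw [← integral_const_mul]
      refine integral_mono hint (hw.const_mul _) fun ξ => ?_
      simp only [hgf, ← mul_assoc]
      exact mul_le_mul_of_nonneg_right (hm.norm_sq_mul_mN_sq_le hs0 hs hN ξ) (sq_nonneg _)
    have hX : 0 ≤ (N ^ (1 - s)) ^ 2 * ∫ ξ, ‖ξ‖ ^ (2 * s) * ‖𝓕 f ξ‖ ^ 2 := by positivity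
    have hD4 : 0 ≤ D ^ 4 := by positivity
    have h1 := mul_le_mul_of_nonneg_left hkey (show 0 ≤ 2 * Real.pi ^ 2 by positivity)
    nlinarith [mul_nonneg hD4 hX, mul_nonneg hD4 hf4, mul_nonneg (sq_nonneg Real.pi) hf4]
  · have hw : Integrable fun ξ : Rn n => jap ξ ^ (2 * s) * ‖𝓕 f ξ‖ ^ 2 := by
      simp only [jap_rpow_two_mul]
      exact SchwartzMap.integrable_mul_norm_sq_of_le (by fun_prop) (fun ξ => by positivity)
        hbase (𝓕 f)
    have hkey : ∫ ξ, jap ξ ^ (2 * s) * ‖𝓕 f ξ‖ ^ 2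
        ≤ 5 * ((∫ ξ, ‖𝓕 f ξ‖ ^ 2) + ∫ ξ, ‖ξ‖ ^ 2 * ‖𝓕 g ξ‖ ^ 2) := by
      have h2 := SchwartzMap.integrable_norm_pow two_ne_zero (𝓕 f)
      rw [← integral_add h2 hint, ← integral_const_mul]
      refine integral_mono hw ((h2.add hint).const_mul _) fun ξ => ?_
      have := mul_le_mul_of_nonneg_right (hm.jap_rpow_le hs0 hs hN ξ) (sq_nonneg ‖𝓕 f ξ‖)
      simp only [hgf]
      linarith
    have hle : (∫ ξ, ‖𝓕 f ξ‖ ^ 2) + ∫ ξ, ‖ξ‖ ^ 2 * ‖𝓕 g ξ‖ ^ 2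
        ≤ 2 * Real.pi ^ 2 * (∫ ξ, ‖ξ‖ ^ 2 * ‖𝓕 g ξ‖ ^ 2) + 1 / 4 * (∫ x, ‖g x‖ ^ 4)
          + ∫ ξ, ‖𝓕 f ξ‖ ^ 2 := by
      nlinarith
    refine hkey.trans (mul_le_mul ?_ hle (by positivity) (by positivity))
    nlinarith [pow_nonneg hD 4, sq_nonneg Real.pi]

end
end
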